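/- For every positive integer n, the number of representations of n by x1^2 + x2^2 + x3^2 + x4^2 + 2x5^2 + 4(x6^2+x7^2+x8^2) equals (16/11)σ_{3;χ8,1}(n) + (2/11)σ_{3;1,χ8}(n/2) + (4/11)a1(n) + (68/11)a2(n) + (180/11)a1(n/2) + (104/11)a2(n/2), with terms of non-integer argument interpreted as 0. -/

import Mathlib

open Complex Real Finset

/-- The Dedekind eta function `η(z) = q^{1/24} ∏ (1 - q^m)`, `q = e^{2πiz}`. -/
noncomputable def dedekindEta (z : ℂ) : ℂ :=
  Complex.exp (Real.pi * Complex.I * z / 12) *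
    ∏' m : ℕ, (1 - Complex.exp (2 * Real.pi * Complex.I * (m + 1) * z))

/-- `repCount a n` is the number of `(x₁,…,x₈) ∈ ℤ⁸` with `∑ aᵢ xᵢ² = n`. -/
noncomputable def repCount (a : Fin 8 → ℕ) (n : ℕ) : ℕ :=
  Nat.card {x : Fin 8 → ℤ // ∑ i, (a i : ℤ) * x i ^ 2 = (n : ℤ)}

/-- `σ_{3;1,χ₈}(n) = ∑_{d ∣ n} χ₈(d) d³`. -/
def sigmaOneChi8 (n : ℕ) : ℤ := ∑ d ∈ n.divisors, ZMod.χ₈ (d : ZMod 8) * (d : ℤ) ^ 3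

/-- `σ_{3;χ₈,1}(n) = ∑_{d ∣ n} χ₈(n/d) d³`. -/
def sigmaChi8One (n : ℕ) : ℤ := ∑ d ∈ n.divisors, ZMod.χ₈ ((n / d : ℕ) : ZMod 8) * (d : ℤ) ^ 3

/-- `f(n/2)` when `2 ∣ n`, and `0` otherwise. -/
def half (f : ℕ → ℤ) (n : ℕ) : ℚ := if 2 ∣ n then (f (n / 2) : ℚ) else 0

namespace RF8
open PowerSeries

/-- Substitution `q ↦ q^k`. -/
noncomputable def ex (k : ℕ) [NeZero k] : ℚ⟦X⟧ →ₐ[ℚ] ℚ⟦X⟧ := PowerSeries.expand k (NeZero.ne k)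

/-- Substitution `q ↦ -q`. -/
noncomputable def ng : ℚ⟦X⟧ →+* ℚ⟦X⟧ := PowerSeries.rescale (-1 : ℚ)

/-- The operator `q d/dq`. -/
noncomputable def DD (f : ℚ⟦X⟧) : ℚ⟦X⟧ := X * d⁄dX ℚ f

lemma coeff_ex (k : ℕ) [NeZero k] (f : ℚ⟦X⟧) (n : ℕ) :
    coeff n (ex k f) = if k ∣ n then coeff (n / k) f else 0 := by
  unfold ex; rw [PowerSeries.coeff_expand]

lemma coeff_ng (f : ℚ⟦X⟧) (n : ℕ) : coeff n (ng f) = (-1) ^ n * coeff n f := by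
  unfold ng; rw [PowerSeries.coeff_rescale]

lemma coeff_DD (f : ℚ⟦X⟧) (n : ℕ) : coeff n (DD f) = n * coeff n f := by
  unfold DD
  cases n with
  | zero => simp
  | succ n => rw [coeff_succ_X_mul, coeff_derivative]; push_cast; ring

lemma DD_add (f g : ℚ⟦X⟧) : DD (f + g) = DD f + DD g := by
  unfold DD; rw [map_add]; ring

lemma DD_sub (f g : ℚ⟦X⟧) : DD (f - g) = DD f - DD g := by
  unfold DD; rw [map_sub]; ring

lemma DD_mul (f g : ℚ⟦X⟧) : DD (f * g) = f * DD g + g * DD f := by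
  unfold DD; rw [Derivation.leibniz]; simp only [smul_eq_mul]; ring

lemma DD_one : DD 1 = 0 := by
  unfold DD; rw [derivative_one]; ring

lemma DD_pow (f : ℚ⟦X⟧) (n : ℕ) : DD (f ^ (n + 1)) = (n + 1 : ℕ) * f ^ n * DD f := by
  unfold DD; rw [derivative_pow]; simp; ring

lemma DD_natCast (n : ℕ) : DD (n : ℚ⟦X⟧) = 0 := by
  unfold DD; simp

lemma DD_X : DD X = X := by
  unfold DD; rw [derivative_X]; ring

lemma DD_ex (k : ℕ) [NeZero k] (f : ℚ⟦X⟧) : DD (ex k f) = k * ex k (DD f) := by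
  ext n
  rw [show (k : ℚ⟦X⟧) = C (k : ℚ) by simp, coeff_C_mul, coeff_DD, coeff_ex, coeff_ex]
  split_ifs with h
  · obtain ⟨m, rfl⟩ := h
    rw [Nat.mul_div_cancel_left _ (Nat.pos_of_ne_zero (NeZero.ne k)), coeff_DD]
    push_cast; ring
  · ring

lemma ex_ex (k l m : ℕ) [NeZero k] [NeZero l] [NeZero m] (h : k * l = m) (f : ℚ⟦X⟧) :
    ex k (ex l f) = ex m f := by
  subst h
  unfold ex
  rw [PowerSeries.expand_mul k (NeZero.ne k) l (NeZero.ne l)]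

lemma ng_ng (f : ℚ⟦X⟧) : ng (ng f) = f := by
  ext n; rw [coeff_ng, coeff_ng, ← mul_assoc, ← mul_pow]; simp

lemma ng_ex_even (k : ℕ) [NeZero k] (hk : Even k) (f : ℚ⟦X⟧) : ng (ex k f) = ex k f := by
  ext n; rw [coeff_ng, coeff_ex]
  split_ifs with h
  · rw [Even.neg_one_pow (hk.trans_dvd h)]; ring
  · ring

lemma ex_X (k : ℕ) [NeZero k] : ex k X = X ^ k := by
  unfold ex; simp

lemma order_ex (k : ℕ) [NeZero k] (f : ℚ⟦X⟧) : (ex k f).order = k * f.order := by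
  unfold ex; rw [order_expand]; simp

/-- coefficients 0 and 1 of products -/
lemma coeff_zero_mul' (f g : ℚ⟦X⟧) : coeff 0 (f * g) = coeff 0 f * coeff 0 g := by
  simp

lemma coeff_one_mul' (f g : ℚ⟦X⟧) :
    coeff 1 (f * g) = coeff 0 f * coeff 1 g + coeff 1 f * coeff 0 g := by
  rw [coeff_mul, Finset.Nat.antidiagonal_succ]; simp

/-- Theta-type series `∑ u(x) q^{x²}`. -/
noncomputable def Th (u : ℤ → ℚ) : ℚ⟦X⟧ :=
  mk fun n => ∑ x ∈ (Finset.Icc (-(n : ℤ)) n).filter (fun x => x ^ 2 = (n : ℤ)), u x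

/-- lattice points on a circle -/
noncomputable def Tn (n : ℕ) : Finset (ℤ × ℤ) :=
  ((Finset.Icc (-(n : ℤ)) n) ×ˢ (Finset.Icc (-(n : ℤ)) n)).filter
    (fun p => p.1 ^ 2 + p.2 ^ 2 = (n : ℤ))

lemma mem_box {x : ℤ} {n : ℕ} (h : x ^ 2 ≤ (n : ℤ)) : -(n : ℤ) ≤ x ∧ x ≤ n := by
  constructor <;> nlinarith

lemma mem_Tn {n : ℕ} {p : ℤ × ℤ} : p ∈ Tn n ↔ p.1 ^ 2 + p.2 ^ 2 = (n : ℤ) := by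
  unfold Tn
  simp only [mem_filter, mem_product, mem_Icc, and_iff_right_iff_imp]
  intro h
  exact ⟨mem_box (by nlinarith [sq_nonneg p.2]), mem_box (by nlinarith [sq_nonneg p.1])⟩

lemma mem_sq {n : ℕ} {x : ℤ} :
    x ∈ (Finset.Icc (-(n : ℤ)) n).filter (fun x => x ^ 2 = (n : ℤ)) ↔ x ^ 2 = (n : ℤ) := by
  simp only [mem_filter, mem_Icc, and_iff_right_iff_imp]
  intro h; exact mem_box h.le

lemma coeff_Th_mul (u v : ℤ → ℚ) (n : ℕ) :
    coeff n (Th u * Th v) = ∑ p ∈ Tn n, u p.1 * v p.2 := by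
  rw [coeff_mul]
  simp only [Th, coeff_mk, Finset.sum_mul_sum]
  simp only [← Finset.sum_product']
  rw [Finset.sum_sigma']
  refine Finset.sum_bij' (fun s _ => s.2) (fun p _ => ⟨((p.1 ^ 2).toNat, (p.2 ^ 2).toNat), p⟩)
    ?_ ?_ ?_ ?_ ?_
  · rintro ⟨⟨i, j⟩, ⟨x, y⟩⟩ h
    simp only [mem_sigma, HasAntidiagonal.mem_antidiagonal, mem_product, mem_sq] at h
    rw [mem_Tn]; dsimp only at *
    rw [h.2.1, h.2.2]; exact_mod_cast h.1
  · rintro ⟨x, y⟩ h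
    rw [mem_Tn] at h; dsimp only at h
    simp only [mem_sigma, HasAntidiagonal.mem_antidiagonal, mem_product, mem_sq]
    have h1 := sq_nonneg x
    have h2 := sq_nonneg y
    refine ⟨?_, ?_, ?_⟩ <;> omega
  · rintro ⟨⟨i, j⟩, ⟨x, y⟩⟩ h
    simp only [mem_sigma, HasAntidiagonal.mem_antidiagonal, mem_product, mem_sq] at h
    have h1 := h.2.1
    have h2 := h.2.2
    simp only [h1, h2, Int.toNat_natCast]
  · rintro ⟨x, y⟩ h; rfl
  · rintro ⟨⟨i, j⟩, ⟨x, y⟩⟩ h; rfl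

lemma sum_Tn_two_mul (m : ℕ) (F : ℤ × ℤ → ℚ) :
    ∑ p ∈ Tn (2 * m), F p = ∑ p ∈ Tn m, F (p.1 + p.2, p.1 - p.2) := by
  symm
  refine Finset.sum_bij' (fun p _ => (p.1 + p.2, p.1 - p.2))
    (fun p _ => ((p.1 + p.2) / 2, (p.1 - p.2) / 2)) ?_ ?_ ?_ ?_ ?_
  · rintro ⟨x, y⟩ h
    rw [mem_Tn] at *; dsimp only at *; push_cast; linear_combination 2 * h
  · rintro ⟨x, y⟩ h
    rw [mem_Tn] at *; dsimp only at *; push_cast at h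
    have hp : (x + y) % 2 = 0 := by
      rcases Int.even_or_odd' x with ⟨k, rfl | rfl⟩ <;> rcases Int.even_or_odd' y with ⟨l, rfl | rfl⟩
      · omega
      · ring_nf at h; omega
      · ring_nf at h; omega
      · omega
    obtain ⟨s, hs⟩ : ∃ s, x + y = 2 * s := ⟨(x + y) / 2, by omega⟩
    obtain ⟨t, ht⟩ : ∃ t, x - y = 2 * t := ⟨(x - y) / 2, by omega⟩
    rw [hs, ht, Int.mul_ediv_cancel_left _ two_ne_zero, Int.mul_ediv_cancel_left _ two_ne_zero]
    have hx : x = s + t := by omega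
    have hy : y = s - t := by omega
    subst hx hy
    linarith [show (s + t) ^ 2 + (s - t) ^ 2 = 2 * (s ^ 2 + t ^ 2) by ring]
  · rintro ⟨x, y⟩ h; ext <;> dsimp only <;> omega
  · rintro ⟨x, y⟩ h
    rw [mem_Tn] at h; dsimp only at h; push_cast at h
    have hp : (x + y) % 2 = 0 := by
      rcases Int.even_or_odd' x with ⟨k, rfl | rfl⟩ <;> rcases Int.even_or_odd' y with ⟨l, rfl | rfl⟩
      · omega
      · ring_nf at h; omega
      · ring_nf at h; omega
      · omega
    ext <;> dsimp only <;> omega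
  · rintro ⟨x, y⟩ h; rfl

/-- sign character on integers -/
def sg (x : ℤ) : ℚ := if Even x then 1 else -1

lemma sg_add (x y : ℤ) : sg (x + y) = sg x * sg y := by
  unfold sg
  by_cases hx : Even x <;> by_cases hy : Even y <;> simp [hx, hy, Int.even_add]

lemma sg_sub (x y : ℤ) : sg (x - y) = sg x * sg y := by
  unfold sg
  by_cases hx : Even x <;> by_cases hy : Even y <;> simp [hx, hy, Int.even_sub]

lemma sg_sq (x : ℤ) : sg (x ^ 2) = sg x := by
  unfold sg; simp [Int.even_pow]

lemma sg_nat (n : ℕ) : sg (n : ℤ) = (-1) ^ n := by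
  unfold sg
  split_ifs with h
  · rw [Int.even_coe_nat] at h; rw [h.neg_one_pow]
  · rw [Int.even_coe_nat, Nat.not_even_iff_odd] at h; rw [h.neg_one_pow]

lemma ng_Th (u : ℤ → ℚ) : ng (Th u) = Th (fun x => sg x * u x) := by
  ext n
  rw [coeff_ng]; simp only [Th, coeff_mk, mul_sum]
  refine Finset.sum_congr rfl fun x hx => ?_
  rw [mem_sq] at hx
  rw [← sg_nat, ← hx, sg_sq]

noncomputable def A : ℚ⟦X⟧ := Th (fun _ => 1)
noncomputable def B : ℚ⟦X⟧ := Th sg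
noncomputable def Cc : ℚ⟦X⟧ := ex 2 A
noncomputable def Dc : ℚ⟦X⟧ := ex 2 B
noncomputable def Ec : ℚ⟦X⟧ := ex 4 A

lemma ng_A : ng A = B := by
  unfold A B; rw [ng_Th]; simp

lemma ng_B : ng B = A := by
  rw [← ng_A, ng_ng]

lemma A_sq_add : A * A + B * B = 2 * (Cc * Cc) := by
  ext n
  rw [show (2 : ℚ⟦X⟧) = C (2 : ℚ) from (map_ofNat C 2).symm, coeff_C_mul, Cc, ← map_mul, coeff_ex, map_add]
  unfold A B
  rw [coeff_Th_mul, coeff_Th_mul, ← Finset.sum_add_distrib]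
  split_ifs with h
  · obtain ⟨m, rfl⟩ := h
    rw [sum_Tn_two_mul, Nat.mul_div_cancel_left _ two_pos, coeff_Th_mul, mul_sum]
    refine Finset.sum_congr rfl fun p hp => ?_
    dsimp only
    rw [sg_add, sg_sub]
    have h1 : sg p.1 * sg p.1 = 1 := by unfold sg; split_ifs <;> norm_num
    have h2 : sg p.2 * sg p.2 = 1 := by unfold sg; split_ifs <;> norm_num
    linear_combination h1 * (sg p.2 * sg p.2) + h2
  · rw [mul_zero]
    refine Finset.sum_eq_zero fun p hp => ?_
    rw [mem_Tn] at hp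
    have : sg p.1 * sg p.2 = -1 := by
      rw [← sg_sq p.1, ← sg_sq p.2, ← sg_add, hp, sg_nat]
      rw [← even_iff_two_dvd, Nat.not_even_iff_odd] at h; exact h.neg_one_pow
    linarith

lemma A_mul_B : A * B = Dc * Dc := by
  ext n
  rw [Dc, ← map_mul, coeff_ex]
  unfold A B
  rw [coeff_Th_mul]
  split_ifs with h
  · obtain ⟨m, rfl⟩ := h
    rw [sum_Tn_two_mul, Nat.mul_div_cancel_left _ two_pos, coeff_Th_mul]
    refine Finset.sum_congr rfl fun p hp => ?_
    dsimp only
    rw [sg_sub]; ring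
  · have hs : ∑ p ∈ Tn n, (1 : ℚ) * sg p.2 = ∑ p ∈ Tn n, (1 : ℚ) * sg p.1 := by
      refine Finset.sum_bij' (fun p _ => (p.2, p.1)) (fun p _ => (p.2, p.1)) ?_ ?_ ?_ ?_ ?_
      · rintro ⟨x, y⟩ h; rw [mem_Tn] at *; dsimp only at *; linarith
      · rintro ⟨x, y⟩ h; rw [mem_Tn] at *; dsimp only at *; linarith
      · rintro ⟨x, y⟩ h; rfl
      · rintro ⟨x, y⟩ h; rfl
      · rintro ⟨x, y⟩ h; rfl
    have ht : ∑ p ∈ Tn n, (1 : ℚ) * sg p.2 = - ∑ p ∈ Tn n, (1 : ℚ) * sg p.1 := by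
      rw [← Finset.sum_neg_distrib]
      refine Finset.sum_congr rfl fun p hp => ?_
      rw [mem_Tn] at hp
      have : sg p.1 * sg p.2 = -1 := by
        rw [← sg_sq p.1, ← sg_sq p.2, ← sg_add, hp, sg_nat]
        rw [← even_iff_two_dvd, Nat.not_even_iff_odd] at h; exact h.neg_one_pow
      have h1 : sg p.1 * sg p.1 = 1 := by unfold sg; split_ifs <;> norm_num
      linear_combination sg p.1 * this - sg p.2 * h1
    linarith

lemma A_add_B : A + B = 2 * Ec := by
  ext n
  rw [show (2 : ℚ⟦X⟧) = C (2 : ℚ) from (map_ofNat C 2).symm, coeff_C_mul, Ec, coeff_ex, map_add]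
  unfold A B Th
  simp only [coeff_mk, ← Finset.sum_add_distrib]
  split_ifs with h
  · obtain ⟨m, rfl⟩ := h
    rw [Nat.mul_div_cancel_left _ (by norm_num), mul_sum]
    refine Finset.sum_bij' (fun x _ => x / 2) (fun x _ => 2 * x) ?_ ?_ ?_ ?_ ?_
    · intro x hx
      rw [mem_sq] at *
      rcases Int.even_or_odd' x with ⟨k, rfl | rfl⟩
      · rw [Int.mul_ediv_cancel_left _ two_ne_zero]; push_cast at hx; linarith
      · push_cast at hx; ring_nf at hx; omega
    · intro x hx
      rw [mem_sq] at *; push_cast; linarith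
    · intro x hx
      rw [mem_sq] at *
      rcases Int.even_or_odd' x with ⟨k, rfl | rfl⟩
      · omega
      · push_cast at hx; ring_nf at hx; omega
    · intro x hx; omega
    · intro x hx
      rw [mem_sq] at *
      have : sg x = 1 := by
        rw [← sg_sq, hx, sg_nat]; exact Even.neg_one_pow ⟨2 * m, by ring⟩
      rw [this]; norm_num
  · rw [mul_zero]
    refine Finset.sum_eq_zero fun x hx => ?_
    rw [mem_sq] at hx
    rcases Int.even_or_odd' x with ⟨k, rfl | rfl⟩
    · exfalso; apply h
      have : (4 : ℤ) ∣ (n : ℤ) := ⟨k ^ 2, by rw [← hx]; ring⟩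
      exact_mod_cast this
    · have : ¬ Even (2 * k + 1) := by simp
      unfold sg; rw [if_neg this]; norm_num

lemma coeff_zero_Th (u : ℤ → ℚ) : coeff 0 (Th u) = u 0 := by
  unfold Th; rw [coeff_mk]; 
  have : (Finset.Icc (-((0 : ℕ) : ℤ)) (0 : ℕ)).filter (fun x => x ^ 2 = ((0 : ℕ) : ℤ)) = {0} := by decide
  rw [this]; simp

lemma coeff_one_Th (u : ℤ → ℚ) : coeff 1 (Th u) = u (-1) + u 1 := by
  unfold Th; rw [coeff_mk]; 
  have : (Finset.Icc (-((1 : ℕ) : ℤ)) (1 : ℕ)).filter (fun x => x ^ 2 = ((1 : ℕ) : ℤ)) = {-1, 1} := by decide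
  rw [this]; simp

lemma A0 : coeff 0 A = 1 := coeff_zero_Th _
lemma A1 : coeff 1 A = 2 := by unfold A; rw [coeff_one_Th]; norm_num
lemma B0 : coeff 0 B = 1 := by unfold B; rw [coeff_zero_Th]; unfold sg; simp
lemma B1 : coeff 1 B = -2 := by
  rw [← ng_A, coeff_ng, A1]; norm_num
lemma C0 : coeff 0 Cc = 1 := by unfold Cc; rw [coeff_ex]; simpa using A0
lemma C1 : coeff 1 Cc = 0 := by unfold Cc; rw [coeff_ex]; simp
lemma D0 : coeff 0 Dc = 1 := by unfold Dc; rw [coeff_ex]; simpa using B0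
lemma E0 : coeff 0 Ec = 1 := by unfold Ec; rw [coeff_ex]; simpa using A0

lemma ne_zero_of_coeff {f : ℚ⟦X⟧} (n : ℕ) (h : coeff n f ≠ 0) : f ≠ 0 := by
  rintro rfl; simp at h

lemma A_ne : A ≠ 0 := ne_zero_of_coeff 0 (by rw [A0]; norm_num)
lemma B_ne : B ≠ 0 := ne_zero_of_coeff 0 (by rw [B0]; norm_num)
lemma C_ne : Cc ≠ 0 := ne_zero_of_coeff 0 (by rw [C0]; norm_num)
lemma D_ne : Dc ≠ 0 := ne_zero_of_coeff 0 (by rw [D0]; norm_num)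

lemma ex2_C : ex 2 Cc = Ec := ex_ex 2 2 4 rfl A

end RF8

namespace RF8
open PowerSeries

/-- The Euler product `∏ (1 - q^m)` as a formal series. -/
noncomputable def h : ℚ⟦X⟧ := pentagonalSeries ℚ

noncomputable def Hp (n : ℕ) : ℚ⟦X⟧ := ∏ k ∈ range n, (1 - X ^ (k + 1))

lemma eq_of_dvd {f g : ℚ⟦X⟧} (H : ∀ n : ℕ, X ^ (n + 1) ∣ f - g) : f = g := by
  ext n
  have := X_pow_dvd_iff.1 (H n) n (Nat.lt_succ_self n)
  rw [map_sub] at this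
  linarith

lemma Hp_stable (n m : ℕ) (hm : n ≤ m) : (X : ℚ⟦X⟧) ^ (n + 1) ∣ Hp m - Hp n := by
  induction m, hm using Nat.le_induction with
  | base => simp
  | succ m hm ih =>
    have : Hp (m + 1) - Hp n = (Hp m - Hp n) - Hp m * X ^ (m + 1) := by
      unfold Hp; rw [prod_range_succ]; ring
    rw [this]
    exact dvd_sub ih (Dvd.dvd.mul_left (pow_dvd_pow _ (by omega)) _)

lemma h_dvd (n : ℕ) : (X : ℚ⟦X⟧) ^ (n + 1) ∣ h - Hp n := by
  rw [X_pow_dvd_iff]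
  intro m hm
  have h1 := coeff_prod_one_sub_X_pow_eventually_eq ℚ m
  have h2 := Filter.tendsto_finset_range.eventually h1
  rw [Filter.eventually_atTop] at h2
  obtain ⟨N, hN⟩ := h2
  have h3 := hN (max N n) (le_max_left _ _)
  have h4 := X_pow_dvd_iff.1 (Hp_stable n (max N n) (le_max_right _ _)) m hm
  rw [map_sub] at h4 ⊢
  unfold h Hp at *
  linarith

lemma h0 : coeff 0 h = 1 := by
  have := X_pow_dvd_iff.1 (h_dvd 0) 0 (by norm_num)
  rw [map_sub] at this
  simp [Hp] at this
  simp
  linarith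

lemma h_ne : h ≠ 0 := ne_zero_of_coeff 0 (by rw [h0]; norm_num)

lemma ex_ne (k : ℕ) [NeZero k] {f : ℚ⟦X⟧} (hf : coeff 0 f = 1) : ex k f ≠ 0 :=
  ne_zero_of_coeff 0 (by rw [coeff_ex]; simp at hf ⊢; rw [hf]; norm_num)

/-- partial theta sums -/
noncomputable def Sn (n : ℕ) : ℚ⟦X⟧ := 1 + ∑ k ∈ range n, 2 * (-1) ^ (k + 1) * X ^ ((k + 1) ^ 2)

lemma B_dvd (n : ℕ) : (X : ℚ⟦X⟧) ^ (n + 1) ∣ B - Sn n := by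
  rw [X_pow_dvd_iff]
  intro m hm
  rw [map_sub]
  unfold Sn
  rw [map_add, map_sum]
  have key : ∀ k, coeff m (2 * (-1) ^ (k + 1) * X ^ ((k + 1) ^ 2) : ℚ⟦X⟧)
      = if m = (k + 1) ^ 2 then 2 * (-1) ^ (k + 1) else 0 := by
    intro k
    rw [show (2 * (-1) ^ (k + 1) : ℚ⟦X⟧) = C (2 * (-1) ^ (k + 1) : ℚ) by
      rw [map_mul, map_pow, map_neg, map_one, map_ofNat], coeff_C_mul, coeff_X_pow]
    split_ifs <;> ring
  simp only [key]
  unfold B Th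
  rw [coeff_mk]
  by_cases hs : ∃ r : ℕ, m = r ^ 2
  · obtain ⟨r, rfl⟩ := hs
    cases r with
    | zero =>
      have hz := coeff_zero_Th sg
      unfold Th at hz
      rw [coeff_mk] at hz
      have h2 : (0 : ℕ) ^ 2 = 0 := rfl
      rw [h2, hz, Finset.sum_eq_zero]
      · simp [sg]
      · intro k _
        rw [if_neg]
        have : 0 < (k + 1) ^ 2 := by positivity
        omega
    | succ r =>
      have hset : (Finset.Icc (-(((r + 1) ^ 2 : ℕ) : ℤ)) ((r + 1) ^ 2 : ℕ)).filter
          (fun x => x ^ 2 = (((r + 1) ^ 2 : ℕ) : ℤ)) = {((r : ℤ) + 1), -((r : ℤ) + 1)} := by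
        ext x
        rw [mem_sq]
        push_cast
        rw [sq_eq_sq_iff_eq_or_eq_neg]
        simp
      rw [hset, Finset.sum_pair (by omega)]
      have e1 : ∀ k : ℕ, ((r + 1) ^ 2 = (k + 1) ^ 2) ↔ r = k := by
        intro k
        constructor
        · intro h
          have := Nat.pow_left_injective (n := 2) (by norm_num) h
          omega
        · rintro rfl; rfl
      simp only [e1]
      have hr : r ∈ range n := by
        rw [mem_range]; nlinarith
      rw [Finset.sum_ite_eq, if_pos hr, coeff_one, if_neg (by positivity)]
      have e2 : sg (-((r : ℤ) + 1)) = sg ((r : ℤ) + 1) := by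
        simp only [sg, even_neg]
      rw [e2, show (r : ℤ) + 1 = ((r + 1 : ℕ) : ℤ) by push_cast; ring, sg_nat]
      ring
  · push Not at hs
    rw [Finset.sum_eq_zero, Finset.sum_eq_zero, coeff_one, if_neg]
    · ring
    · have := hs 0; simpa using this
    · intro k _; rw [if_neg (hs (k + 1))]
    · intro x hx
      rw [mem_sq] at hx
      exfalso; apply hs x.natAbs
      zify; rw [sq_abs, hx]

noncomputable def Iv (s : ℕ) : ℚ⟦X⟧ := (1 + X ^ s)⁻¹
noncomputable def Pp : ℕ → ℚ⟦X⟧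
  | 0 => 1
  | n + 1 => Pp n * ((1 - X ^ (n + 1)) * Iv (n + 1))
noncomputable def Jv (s : ℕ) : ℚ⟦X⟧ := (Pp s)⁻¹

lemma Iv_spec (s : ℕ) : (1 + X ^ s) * Iv s = 1 := by
  unfold Iv
  apply PowerSeries.mul_inv_cancel
  cases s <;> simp

lemma Pp_const (s : ℕ) : constantCoeff (Pp s) = 1 := by
  induction s with
  | zero => simp [Pp]
  | succ n ih =>
    have := congrArg constantCoeff (Iv_spec (n + 1))
    simp at this
    simp [Pp, ih, this]

lemma Jv_spec (s : ℕ) : Pp s * Jv s = 1 := by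
  unfold Jv
  apply PowerSeries.mul_inv_cancel
  rw [Pp_const]; norm_num

lemma Jv_succ (s : ℕ) : (1 - X ^ (s + 1)) * Iv (s + 1) * Jv (s + 1) = Jv s := by
  have h1 := Jv_spec (s + 1)
  have h2 := Jv_spec s
  simp only [Pp] at h1
  linear_combination Jv s * h1 - (1 - X ^ (s + 1)) * Iv (s + 1) * Jv (s + 1) * h2

noncomputable def Tt (n s : ℕ) : ℚ⟦X⟧ := 2 * (-1) ^ s * X ^ (s * (n + 1)) * Iv s * Pp n * Jv s

noncomputable def Vv (n : ℕ) : ℕ → ℚ⟦X⟧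
  | 0 => 0
  | s + 1 => (-1) ^ (s + 1) * X ^ ((s + 1) * (n + 1)) * Jv s

lemma Tt_diff (n s : ℕ) : Tt (n + 1) s - Tt n s = 2 * Pp n * Iv (n + 1) * (Vv n (s + 1) - Vv n s) := by
  have hn := Iv_spec (n + 1)
  cases s with
  | zero =>
    have h0 := Iv_spec 0
    simp only [Tt, Vv, Pp, pow_zero, zero_mul] at *
    simp only [zero_add, one_mul, pow_one]
    linear_combination (Pp n * Jv 0 * Iv 0 * 2) * hn - 2 * X ^ (n + 1) * Pp n * Jv 0 * Iv (n + 1) * h0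
  | succ r =>
    have h1 := Iv_spec (r + 1)
    have h2 := Jv_succ r
    simp only [Tt, Vv, Pp]
    rw [show (r + 1) * (n + 1 + 1) = (r + 1) * (n + 1) + (r + 1) by ring,
      show (r + 1 + 1) * (n + 1) = (r + 1) * (n + 1) + (n + 1) by ring, pow_add X ((r + 1) * (n + 1)),
      pow_add X ((r + 1) * (n + 1)), pow_succ (-1) (r + 1)]
    generalize (X : ℚ⟦X⟧) ^ ((r + 1) * (n + 1)) = z at *
    generalize (X : ℚ⟦X⟧) ^ (r + 1) = y at *
    generalize (X : ℚ⟦X⟧) ^ (n + 1) = x at *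
    linear_combination (2 * (-1) ^ (r + 1) * z * Pp n) * ((Iv (r + 1) * Jv (r + 1)) * hn
      - Iv (n + 1) * h2 - x * Iv (n + 1) * Jv (r + 1) * h1)

lemma Sn_eq (n : ℕ) : Sn n = ∑ s ∈ range (n + 1), Tt n s := by
  induction n with
  | zero =>
    have h0 := Iv_spec 0
    have h1 := Jv_spec 0
    simp [Sn, Tt, Pp] at *
    rw [h1]; linear_combination -h0
  | succ n ih =>
    have e1 : ∑ s ∈ range (n + 1), (Tt (n + 1) s - Tt n s) = 2 * Pp n * Iv (n + 1) * (Vv n (n + 1) - Vv n 0) := by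
      simp only [Tt_diff]
      rw [← mul_sum, Finset.sum_range_sub]
    rw [sum_sub_distrib, ← ih] at e1
    rw [sum_range_succ, sub_eq_iff_eq_add.1 e1]
    have e2 : Sn (n + 1) = Sn n + 2 * (-1) ^ (n + 1) * X ^ ((n + 1) ^ 2) := by
      unfold Sn; rw [sum_range_succ]; ring
    rw [e2]
    have h1 := Jv_spec n
    have h2 := Jv_spec (n + 1)
    have h3 := Iv_spec (n + 1)
    simp only [Tt, Vv]
    rw [show (n + 1) * (n + 1 + 1) = (n + 1) ^ 2 + (n + 1) by ring,
      show (n + 1) * (n + 1) = (n + 1) ^ 2 by ring, pow_add X ((n + 1) ^ 2)]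
    generalize (X : ℚ⟦X⟧) ^ ((n + 1) ^ 2) = z at *
    generalize (X : ℚ⟦X⟧) ^ (n + 1) = x at *
    linear_combination (2 * (-1) ^ (n + 1) * z) * (- h3 - Iv (n + 1) * h1 - x * Iv (n + 1) * h2)

lemma Sn_dvd (n : ℕ) : (X : ℚ⟦X⟧) ^ (n + 1) ∣ Sn n - Pp n := by
  rw [Sn_eq, sum_range_succ']
  have : Tt n 0 = Pp n := by
    have h0 := Iv_spec 0
    have h1 := Jv_spec 0
    simp [Tt, Pp] at *
    rw [h1]; linear_combination Pp n * h0
  rw [this, add_sub_cancel_right]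
  refine Finset.dvd_sum fun s _ => ?_
  unfold Tt
  have : (X : ℚ⟦X⟧) ^ (n + 1) ∣ X ^ ((s + 1) * (n + 1)) := pow_dvd_pow _ (by nlinarith)
  exact (((this.mul_left _).mul_right _).mul_right _).mul_right _

noncomputable def Qp (n : ℕ) : ℚ⟦X⟧ := ∏ k ∈ range n, (1 + X ^ (k + 1))

lemma Pp_mul_Qp (n : ℕ) : Pp n * Qp n = Hp n := by
  induction n with
  | zero => simp [Pp, Qp, Hp]
  | succ n ih =>
    unfold Qp Hp at *
    rw [prod_range_succ, prod_range_succ, ← ih]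
    simp only [Pp]
    linear_combination (Pp n * (∏ k ∈ range n, (1 + X ^ (k + 1))) * (1 - X ^ (n + 1))) * Iv_spec (n + 1)

lemma Hp_mul_Qp (n : ℕ) : Hp n * Qp n = ex 2 (Hp n) := by
  unfold Hp Qp
  rw [← prod_mul_distrib, map_prod]
  refine prod_congr rfl fun k _ => ?_
  rw [map_sub, map_one, map_pow, ex_X]; ring

/-- The Gauss product for `∑ (-1)^x q^{x²}`. -/
lemma gauss : B * ex 2 h = h ^ 2 := by
  apply eq_of_dvd
  intro n
  have hB : (X : ℚ⟦X⟧) ^ (n + 1) ∣ B - Pp n := by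
    have := dvd_add (B_dvd n) (Sn_dvd n)
    simpa using this
  have hh := h_dvd n
  have hh2 : (X : ℚ⟦X⟧) ^ (n + 1) ∣ ex 2 h - ex 2 (Hp n) := by
    obtain ⟨c, hc⟩ := hh
    rw [← map_sub, hc, map_mul, map_pow, ex_X, ← pow_mul]
    exact Dvd.dvd.mul_right (pow_dvd_pow _ (by omega)) _
  have : B * ex 2 h - h ^ 2 = (B - Pp n) * ex 2 h + Pp n * (ex 2 h - ex 2 (Hp n))
      - (h - Hp n) * (h + Hp n) := by
    rw [← Hp_mul_Qp]
    linear_combination Hp n * Pp_mul_Qp n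
  rw [this]
  exact dvd_sub (dvd_add (hB.mul_right _) (hh2.mul_left _)) (hh.mul_right _)

end RF8

namespace RF8
open PowerSeries

/-- Lambert series `∑_{a,x ≥ 1} w(a,x) q^{ax}`. -/
noncomputable def Lam (w : ℕ → ℕ → ℚ) : ℚ⟦X⟧ :=
  mk fun n => ∑ p ∈ n.divisorsAntidiagonal, w p.1 p.2

/-- `∑ σ(n) q^n`. -/
noncomputable def S : ℚ⟦X⟧ := Lam (fun a _ => (a : ℚ))

noncomputable def Gk (k : ℕ) : ℚ⟦X⟧ := mk fun m => if k ∣ m ∧ m ≠ 0 then 1 else 0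

lemma Gk_spec (k : ℕ) (hk : 0 < k) : (1 - X ^ k) * Gk k = X ^ k := by
  ext m
  rw [sub_mul, one_mul, map_sub, coeff_X_pow_mul', coeff_X_pow]
  unfold Gk
  simp only [coeff_mk]
  by_cases h1 : k ≤ m
  · obtain ⟨r, rfl⟩ := Nat.exists_eq_add_of_le h1
    rw [if_pos h1, Nat.add_sub_cancel_left]
    by_cases h2 : k ∣ r
    · by_cases h3 : r = 0
      · subst h3; simp [hk.ne']
      · rw [if_pos ⟨by simpa using h2, by omega⟩, if_pos ⟨h2, h3⟩, if_neg (by omega)]; ring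
    · rw [if_neg, if_neg, if_neg]
      · ring
      · rintro h; apply h2; rw [show r = 0 by omega]; simp
      · tauto
      · rintro ⟨h, -⟩; apply h2; simpa using h
  · rw [if_neg h1, if_neg, if_neg]
    · ring
    · omega
    · rintro ⟨h, h'⟩; exact h1 (Nat.le_of_dvd (by omega) h)

lemma DD_Hp (n : ℕ) : DD (Hp n) = - Hp n * ∑ k ∈ range n, ((k + 1 : ℕ) : ℚ⟦X⟧) * Gk (k + 1) := by
  induction n with
  | zero => simp [Hp, DD_one]
  | succ n ih =>
    have e : Hp (n + 1) = Hp n * (1 - X ^ (n + 1)) := by unfold Hp; rw [prod_range_succ]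
    rw [sum_range_succ, e, DD_mul, ih, DD_sub, DD_one, DD_pow, DD_X]
    have := Gk_spec (n + 1) (by omega)
    linear_combination (Hp n * ((n + 1 : ℕ) : ℚ⟦X⟧)) * this

lemma S_dvd (n : ℕ) : (X : ℚ⟦X⟧) ^ (n + 1) ∣ S - ∑ k ∈ range n, ((k + 1 : ℕ) : ℚ⟦X⟧) * Gk (k + 1) := by
  rw [X_pow_dvd_iff]
  intro m hm
  rw [map_sub, map_sum, sub_eq_zero]
  unfold S Lam
  rw [coeff_mk, Nat.sum_divisorsAntidiagonal (f := fun a _ => (a : ℚ))]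
  have e : ∀ k : ℕ, coeff m (((k + 1 : ℕ) : ℚ⟦X⟧) * Gk (k + 1))
      = if (k + 1) ∣ m ∧ m ≠ 0 then ((k + 1 : ℕ) : ℚ) else 0 := by
    intro k
    rw [show ((k + 1 : ℕ) : ℚ⟦X⟧) = C ((k + 1 : ℕ) : ℚ) by simp, coeff_C_mul]
    unfold Gk; rw [coeff_mk]; simp
  simp only [e]
  rw [← Finset.sum_filter]
  refine Finset.sum_bij' (fun d _ => d - 1) (fun d _ => d + 1) ?_ ?_ ?_ ?_ ?_
  · intro d hd
    have h1 := Nat.pos_of_mem_divisors hd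
    have h2 := Nat.divisor_le hd
    rw [Nat.mem_divisors] at hd
    rw [mem_filter, mem_range, Nat.sub_add_cancel h1]
    exact ⟨by omega, hd⟩
  · intro d hd
    rw [mem_filter] at hd
    rw [Nat.mem_divisors]; exact hd.2
  · intro d hd
    have h1 := Nat.pos_of_mem_divisors hd
    omega
  · intro d hd; omega
  · intro d hd
    have h1 := Nat.pos_of_mem_divisors hd
    rw [Nat.sub_add_cancel h1]

lemma DD_h : DD h = - h * S := by
  apply eq_of_dvd
  intro n
  have h1 := h_dvd n
  have h2 : (X : ℚ⟦X⟧) ^ (n + 1) ∣ DD (h - Hp n) := by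
    rw [X_pow_dvd_iff] at *
    intro m hm
    rw [coeff_DD, h1 m hm, mul_zero]
  have h3 := S_dvd n
  rw [DD_sub, DD_Hp] at h2
  have := dvd_add (dvd_add h2 (h1.mul_right S)) (h3.mul_left (Hp n))
  convert this using 1
  ring

lemma DD_hk (k : ℕ) [NeZero k] : DD (ex k h) = - (k : ℚ⟦X⟧) * ex k h * ex k S := by
  rw [DD_ex, DD_h, map_mul, map_neg]; ring

noncomputable abbrev h2 : ℚ⟦X⟧ := ex 2 h
noncomputable abbrev h4 : ℚ⟦X⟧ := ex 4 h
noncomputable abbrev h8 : ℚ⟦X⟧ := ex 8 h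
noncomputable abbrev h16 : ℚ⟦X⟧ := ex 16 h
noncomputable abbrev S2 : ℚ⟦X⟧ := ex 2 S
noncomputable abbrev S4 : ℚ⟦X⟧ := ex 4 S
noncomputable abbrev S8 : ℚ⟦X⟧ := ex 8 S
noncomputable abbrev S16 : ℚ⟦X⟧ := ex 16 S

lemma h2_ne : h2 ≠ 0 := ex_ne 2 h0
lemma h4_ne : h4 ≠ 0 := ex_ne 4 h0
lemma h8_ne : h8 ≠ 0 := ex_ne 8 h0
lemma h16_ne : h16 ≠ 0 := ex_ne 16 h0

lemma D_h : Dc * h4 = h2 ^ 2 := by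
  have := congrArg (ex 2) gauss
  rw [map_mul, map_pow, ex_ex 2 2 4 rfl] at this
  exact this

lemma A_h : A * (h ^ 2 * h4 ^ 2) = h2 ^ 5 := by
  have h1 := gauss
  have h3 := D_h
  have h5 := A_mul_B
  have : h2 * (A * (h ^ 2 * h4 ^ 2)) = h2 * (h2 ^ 5 : ℚ⟦X⟧) := by
    linear_combination (h2 ^ 2 + Dc * h4) * h2 ^ 2 * h3 - A * h4 ^ 2 * h2 * h1 + h4 ^ 2 * h2 ^ 2 * h5
  exact mul_left_cancel₀ h2_ne this

lemma C_h : Cc * (h2 ^ 2 * h8 ^ 2) = h4 ^ 5 := by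
  have := congrArg (ex 2) A_h
  simp only [map_mul, map_pow, ex_ex 2 2 4 rfl, ex_ex 2 4 8 rfl] at this
  exact this

lemma E_h : Ec * (h4 ^ 2 * h16 ^ 2) = h8 ^ 5 := by
  have := congrArg (ex 4) A_h
  simp only [map_mul, map_pow, ex_ex 4 2 8 rfl, ex_ex 4 4 16 rfl] at this
  exact this

/-- logarithmic derivative relation -/
def LD (f g : ℚ⟦X⟧) : Prop := DD f = f * g

lemma LD_mul {f g u v : ℚ⟦X⟧} (hf : LD f u) (hg : LD g v) : LD (f * g) (u + v) := by
  unfold LD at *; rw [DD_mul, hf, hg]; ring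

lemma LD_pow {f u : ℚ⟦X⟧} (hf : LD f u) (n : ℕ) : LD (f ^ n) (n * u) := by
  cases n with
  | zero => unfold LD; simp [DD_one]
  | succ n => unfold LD at *; rw [DD_pow, hf]; ring

lemma LD_cancel {f g u v : ℚ⟦X⟧} (hg0 : g ≠ 0) (hg : LD g v) (hfg : LD (f * g) u) : LD f (u - v) := by
  unfold LD at *
  rw [DD_mul, hg] at hfg
  apply mul_left_cancel₀ hg0
  linear_combination hfg

lemma LD_h : LD h (-S) := by unfold LD; rw [DD_h]; ring
lemma LD_hk (k : ℕ) [NeZero k] : LD (ex k h) (-(k : ℚ⟦X⟧) * ex k S) := by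
  unfold LD; rw [DD_hk]; ring

lemma LD_B : LD B (2 * S2 - 2 * S) := by
  have h1 := LD_pow LD_h 2
  rw [← gauss] at h1
  have := LD_cancel h2_ne (LD_hk 2) h1
  convert this using 1
  push_cast; ring

lemma LD_A : LD A (2 * S - 10 * S2 + 8 * S4) := by
  have h1 := LD_pow (LD_hk 2) 5
  rw [← A_h] at h1
  have := LD_cancel (mul_ne_zero (pow_ne_zero 2 h_ne) (pow_ne_zero 2 h4_ne))
    (LD_mul (LD_pow LD_h 2) (LD_pow (LD_hk 4) 2)) h1
  convert this using 1
  push_cast; ring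

lemma LD_ex (k : ℕ) [NeZero k] {f u : ℚ⟦X⟧} (hf : LD f u) : LD (ex k f) (k * ex k u) := by
  unfold LD at *; rw [DD_ex, hf, map_mul]; ring

lemma LD_C : LD Cc (4 * S2 - 20 * S4 + 16 * S8) := by
  have := LD_ex 2 LD_A
  simp only [map_add, map_sub, map_mul, ex_ex 2 2 4 rfl, ex_ex 2 4 8 rfl, map_ofNat] at this
  change LD Cc _ at this
  convert this using 1
  push_cast; unfold S2 S4 S8; ring

lemma LD_E : LD Ec (8 * S4 - 40 * S8 + 32 * S16) := by
  have := LD_ex 4 LD_A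
  simp only [map_add, map_sub, map_mul, ex_ex 4 2 8 rfl, ex_ex 4 4 16 rfl, map_ofNat] at this
  change LD Ec _ at this
  convert this using 1
  push_cast; unfold S4 S8 S16; ring

lemma C_add_D : Cc * Cc + Dc * Dc = 2 * (Ec * Ec) := by
  have := congrArg (ex 2) A_sq_add
  simp only [map_add, map_mul, ex2_C, map_ofNat] at this
  exact this

/-- order argument -/
lemma zero_of_order {f u v : ℚ⟦X⟧} (h0 : coeff 0 f = 0) (h1 : coeff 1 f = 0)
    (hu : coeff 1 u ≠ 0) (hv : coeff 0 v ≠ 0) (H : f * u = v * ex 2 f) : f = 0 := by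
  by_contra hf
  have e := congrArg order H
  rw [order_mul, order_mul, order_ex] at e
  have hv' : v.order = 0 := by
    apply order_eq_nat (n := 0) |>.2
    exact ⟨hv, by simp⟩
  have hu' : u.order ≤ 1 := order_le 1 hu
  have hf2 : (2 : ℕ∞) ≤ f.order := by
    apply nat_le_order (n := 2)
    intro i hi
    interval_cases i
    · exact h0
    · exact h1
  rw [hv', zero_add] at e
  have hft : f.order ≠ ⊤ := by rwa [Ne, order_eq_top]
  have hut : u.order ≠ ⊤ := by rw [Ne, order_eq_top]; exact ne_zero_of_coeff 1 hu
  lift f.order to ℕ using hft with d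
  lift u.order to ℕ using hut with r
  norm_cast at *
  omega

end RF8

set_option linter.unusedSimpArgs false

namespace RF8
open PowerSeries

lemma cf0 (n : ℕ) [n.AtLeastTwo] : coeff 0 (OfNat.ofNat n : ℚ⟦X⟧) = OfNat.ofNat n := by
  rw [← map_ofNat C n, coeff_C]; simp

lemma cf1 (n : ℕ) [n.AtLeastTwo] : coeff 1 (OfNat.ofNat n : ℚ⟦X⟧) = 0 := by
  rw [← map_ofNat C n, coeff_C]; simp

lemma ex0 (k : ℕ) [NeZero k] (f : ℚ⟦X⟧) : coeff 0 (ex k f) = coeff 0 f := by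
  rw [coeff_ex]; simp

lemma ex1 (k : ℕ) [NeZero k] (hk : 1 < k) (f : ℚ⟦X⟧) : coeff 1 (ex k f) = 0 := by
  rw [coeff_ex, if_neg]; rw [Nat.dvd_one]; omega

lemma X0 : coeff 0 (X : ℚ⟦X⟧) = 0 := by simp
lemma X1 : coeff 1 (X : ℚ⟦X⟧) = 1 := by simp
lemma D1 : coeff 1 Dc = 0 := ex1 2 (by norm_num) _
lemma E1' : coeff 1 Ec = 0 := ex1 4 (by norm_num) _
lemma one0 : coeff 0 (1 : ℚ⟦X⟧) = 1 := by simp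
lemma one1 : coeff 1 (1 : ℚ⟦X⟧) = 0 := by rw [coeff_one]; simp
lemma h20 : coeff 0 h2 = 1 := by rw [ex0, h0]
lemma h21 : coeff 1 h2 = 0 := ex1 _ (by norm_num) _
lemma h40 : coeff 0 h4 = 1 := by rw [ex0, h0]
lemma h41 : coeff 1 h4 = 0 := ex1 _ (by norm_num) _
lemma h80 : coeff 0 h8 = 1 := by rw [ex0, h0]
lemma h81 : coeff 1 h8 = 0 := ex1 _ (by norm_num) _
lemma h160 : coeff 0 h16 = 1 := by rw [ex0, h0]
lemma h161 : coeff 1 h16 = 0 := ex1 _ (by norm_num) _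

lemma two_ne : (2 : ℚ⟦X⟧) ≠ 0 := ne_zero_of_coeff 0 (by rw [cf0 2]; norm_num)
lemma four_ne : (4 : ℚ⟦X⟧) ≠ 0 := ne_zero_of_coeff 0 (by rw [cf0 4]; norm_num)

lemma w_sq : (A ^ 2 - B ^ 2) ^ 2 = 8 * (Cc ^ 2 - Dc ^ 2) * Ec ^ 2 := by
  have h1 := A_sq_add
  have h2 := A_mul_B
  have h3 := C_add_D
  linear_combination (A * A + B * B + 2 * Cc * Cc) * h1 - 4 * (A * B + Dc * Dc) * h2
    + 4 * (Cc ^ 2 - Dc ^ 2) * h3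

lemma ex2_w : ex 2 (A ^ 2 - B ^ 2) = Cc ^ 2 - Dc ^ 2 := by
  rw [map_sub, map_pow, map_pow]; rfl

lemma w_h : (A ^ 2 - B ^ 2) * h4 ^ 2 = 8 * X * h8 ^ 4 := by
  have key : (A ^ 2 - B ^ 2) * h4 ^ 2 - 8 * X * h8 ^ 4 = 0 := by
    apply zero_of_order (u := ((A ^ 2 - B ^ 2) * h4 ^ 2 + 8 * X * h8 ^ 4) * h16 ^ 4) (v := 8 * h8 ^ 8)
    · simp only [map_sub, map_add, pow_succ, pow_zero, coeff_one_mul', coeff_zero_mul', A0, B0, A1, B1, h40, h41,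
        h80, h81, h160, h161, X0, X1, cf0 2, cf0 4, cf0 8, cf1 2, cf1 4, cf1 8, one0, one1]; norm_num
    · simp only [map_sub, map_add, pow_succ, pow_zero, coeff_one_mul', coeff_zero_mul', A0, B0, A1, B1, h40, h41,
        h80, h81, h160, h161, X0, X1, cf0 2, cf0 4, cf0 8, cf1 2, cf1 4, cf1 8, one0, one1]; norm_num
    · simp only [map_sub, map_add, pow_succ, pow_zero, coeff_one_mul', coeff_zero_mul', A0, B0, A1, B1, h40, h41,
        h80, h81, h160, h161, X0, X1, cf0 2, cf0 4, cf0 8, cf1 2, cf1 4, cf1 8, one0, one1]; norm_num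
    · simp only [map_sub, map_add, pow_succ, pow_zero, coeff_one_mul', coeff_zero_mul', A0, B0, A1, B1, h40, h41,
        h80, h81, h160, h161, X0, X1, cf0 2, cf0 4, cf0 8, cf1 2, cf1 4, cf1 8, one0, one1]; norm_num
    · have e1 : ex 2 ((A ^ 2 - B ^ 2) * h4 ^ 2 - 8 * X * h8 ^ 4)
          = (Cc ^ 2 - Dc ^ 2) * h8 ^ 2 - 8 * X ^ 2 * h16 ^ 4 := by
        rw [map_sub, map_mul, ex2_w]
        simp only [map_mul, map_pow, map_ofNat, ex_X, ex_ex 2 4 8 rfl, ex_ex 2 8 16 rfl]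
      rw [e1]
      have h1 := w_sq
      have h2 := E_h
      linear_combination h4 ^ 4 * h16 ^ 4 * h1
        + 8 * (Cc ^ 2 - Dc ^ 2) * (Ec * (h4 ^ 2 * h16 ^ 2) + h8 ^ 5) * h2
  linear_combination key

lemma LD_w : LD (A ^ 2 - B ^ 2) (1 + 8 * S4 - 32 * S8) := by
  have e8 : LD (8 : ℚ⟦X⟧) 0 := by
    unfold LD; rw [mul_zero]; exact DD_natCast 8
  have eX : LD X 1 := by unfold LD; rw [DD_X, mul_one]
  have h1 := LD_mul (LD_mul e8 eX) (LD_pow (LD_hk 8) 4)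
  rw [← w_h] at h1
  have := LD_cancel (pow_ne_zero 2 h4_ne) (LD_pow (LD_hk 4) 2) h1
  convert this using 1
  push_cast; ring

lemma W_eq : 4 * (B * DD A - A * DD B) = A * B * (A ^ 4 - B ^ 4) := by
  have key : 4 * (B * DD A - A * DD B) - A * B * (A ^ 4 - B ^ 4) = 0 := by
    apply zero_of_order (u := A ^ 2 - B ^ 2) (v := 8 * Cc * Dc)
    · simp only [map_sub, map_add, pow_succ, pow_zero, coeff_one_mul', coeff_zero_mul', A0, B0, A1, B1, coeff_DD,
        cf0 2, cf0 4, cf0 8, cf1 2, cf1 4, cf1 8, one0, one1]; norm_num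
    · simp only [map_sub, map_add, pow_succ, pow_zero, coeff_one_mul', coeff_zero_mul', A0, B0, A1, B1, coeff_DD,
        cf0 2, cf0 4, cf0 8, cf1 2, cf1 4, cf1 8, one0, one1]; norm_num
    · simp only [map_sub, map_add, pow_succ, pow_zero, coeff_one_mul', coeff_zero_mul', A0, B0, A1, B1, coeff_DD,
        cf0 2, cf0 4, cf0 8, cf1 2, cf1 4, cf1 8, one0, one1]; norm_num
    · simp only [map_sub, map_add, pow_succ, pow_zero, coeff_one_mul', coeff_zero_mul', C0, D0, coeff_DD,
        cf0 2, cf0 4, cf0 8, cf1 2, cf1 4, cf1 8, one0, one1]; norm_num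
    · have hA : 2 * ex 2 (DD A) = DD Cc := by unfold Cc; rw [DD_ex]; norm_num
      have hB : 2 * ex 2 (DD B) = DD Dc := by unfold Dc; rw [DD_ex]; norm_num
      have e1 : ex 2 (4 * (B * DD A - A * DD B) - A * B * (A ^ 4 - B ^ 4))
          = 2 * (Dc * DD Cc - Cc * DD Dc) - Cc * Dc * (Cc ^ 4 - Dc ^ 4) := by
        rw [← hA, ← hB]
        simp only [map_mul, map_sub, map_pow, map_ofNat]
        change 4 * (Dc * ex 2 (DD A) - Cc * ex 2 (DD B)) - Cc * Dc * (Cc ^ 4 - Dc ^ 4) = _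
        ring
      rw [e1]
      have h1 := A_sq_add
      have h2 := A_mul_B
      have h1' := congrArg DD h1
      have h2' := congrArg DD h2
      rw [DD_add, DD_mul, DD_mul, DD_mul, DD_mul, show DD (2 : ℚ⟦X⟧) = 0 from DD_natCast 2] at h1'
      rw [DD_mul, DD_mul] at h2'
      linear_combination 4 * (A * B) * h1' + 4 * (4 * Cc * DD Cc) * h2
        - 4 * (A * A + B * B) * h2' - 4 * (2 * Dc * DD Dc) * h1
        - (A * A + B * B) ^ 3 * h2
        - Dc ^ 2 * ((A * A + B * B) ^ 2 + (A * A + B * B) * (2 * (Cc * Cc)) + (2 * (Cc * Cc)) ^ 2) * h1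
        + 4 * (A * B) ^ 3 * h1
        + 4 * (2 * (Cc * Cc)) * ((A * B) ^ 2 + A * B * (Dc * Dc) + (Dc * Dc) ^ 2) * h2
  linear_combination key

lemma AB_ne : A * B ≠ 0 := mul_ne_zero A_ne B_ne

lemma Rel1 : 16 * (S - 3 * S2 + 2 * S4) = A ^ 4 - B ^ 4 := by
  apply mul_left_cancel₀ AB_ne
  have h1 := W_eq
  have hA : DD A = _ := LD_A
  have hB : DD B = _ := LD_B
  rw [hA, hB] at h1
  linear_combination h1

lemma sum_ne : 2 * (A * A + B * B) ≠ 0 := ne_zero_of_coeff 0 (by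
  simp only [coeff_zero_mul', map_add, A0, B0, cf0 2]; norm_num)

lemma diff_ne : A ^ 2 - B ^ 2 ≠ 0 := ne_zero_of_coeff 1 (by
  simp only [pow_succ, pow_zero, one_mul, coeff_one_mul', map_sub, A0, B0, A1, B1]; norm_num)

lemma add_ne : A + B ≠ 0 := ne_zero_of_coeff 0 (by
  simp only [map_add, A0, B0]; norm_num)

lemma Rel2 : 4 * (2 * S + 2 * S2 - 20 * S4 + 16 * S8) = A ^ 2 * (A ^ 2 - B ^ 2) := by
  apply mul_left_cancel₀ sum_ne
  have h1 := A_sq_add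
  have h1' := congrArg DD h1
  rw [DD_add, DD_mul, DD_mul, DD_mul, DD_mul, show DD (2 : ℚ⟦X⟧) = 0 from DD_natCast 2] at h1'
  have hA : DD A = _ := LD_A
  have hB : DD B = _ := LD_B
  have hC : DD Cc = _ := LD_C
  rw [hA, hB, hC] at h1'
  linear_combination -4 * h1' + 8 * (4 * S2 - 20 * S4 + 16 * S8) * h1 + 2 * A ^ 2 * Rel1

lemma Rel3 : 2 * (1 + 4 * S - 4 * S2 + 8 * S4 - 32 * S8) = A ^ 2 * (A ^ 2 + B ^ 2) := by
  apply mul_left_cancel₀ diff_ne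
  have h1 : DD (A ^ 2 - B ^ 2) = _ := LD_w
  rw [pow_two, pow_two, DD_sub, DD_mul, DD_mul] at h1
  have hA : DD A = _ := LD_A
  have hB : DD B = _ := LD_B
  rw [hA, hB] at h1
  linear_combination -2 * h1 + A ^ 2 * Rel1

lemma Rel4 : 4 * (2 * S - 2 * S2 + 8 * S4 - 40 * S8 + 32 * S16) = A * (A - B) * (A ^ 2 + B ^ 2) := by
  apply mul_left_cancel₀ add_ne
  have h0 := A_add_B
  have h1 := congrArg DD h0
  rw [DD_add, DD_mul, show DD (2 : ℚ⟦X⟧) = 0 from DD_natCast 2] at h1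
  have hA : DD A = _ := LD_A
  have hB : DD B = _ := LD_B
  have hE : DD Ec = _ := LD_E
  rw [hA, hB, hE] at h1
  linear_combination -4 * h1 + 4 * (8 * S4 - 40 * S8 + 32 * S16) * h0 + A * Rel1

lemma Q1rel : 4 * (4 + 24 * S - 24 * S2 - 96 * S8) = 11 * A ^ 4 + 6 * A ^ 2 * B ^ 2 - B ^ 4 := by
  linear_combination 8 * Rel3 + 2 * Rel2 + Rel1

lemma Q2rel : 2 * (11 + 24 * S + 96 * S4 - 384 * S8) = 2 * (4 * A ^ 4 + 6 * A ^ 2 * B ^ 2 + B ^ 4) := by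
  linear_combination 11 * Rel3 - Rel2 - 2 * Rel1

end RF8

namespace RF8
open PowerSeries

/-- Quadruples `(a,b,x,y)` of positive integers with `ax + by = n`. -/
noncomputable def Qn (n : ℕ) : Finset (ℕ × ℕ × ℕ × ℕ) :=
  (Finset.Icc 1 n ×ˢ Finset.Icc 1 n ×ˢ Finset.Icc 1 n ×ˢ Finset.Icc 1 n).filter
    (fun p => p.1 * p.2.2.1 + p.2.1 * p.2.2.2 = n)

lemma mem_Qn {n a b x y : ℕ} : (a, b, x, y) ∈ Qn n ↔
    (0 < a ∧ 0 < b ∧ 0 < x ∧ 0 < y) ∧ a * x + b * y = n := by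
  unfold Qn
  simp only [mem_filter, mem_product, mem_Icc]
  constructor
  · rintro ⟨h, h'⟩; refine ⟨⟨?_, ?_, ?_, ?_⟩, h'⟩ <;> omega
  · rintro ⟨⟨ha, hb, hx, hy⟩, rfl⟩
    refine ⟨⟨⟨ha, ?_⟩, ⟨hb, ?_⟩, ⟨hx, ?_⟩, ⟨hy, ?_⟩⟩, rfl⟩ <;> nlinarith

lemma coeff_Lam (w : ℕ → ℕ → ℚ) (n : ℕ) :
    coeff n (Lam w) = ∑ p ∈ n.divisorsAntidiagonal, w p.1 p.2 := by
  unfold Lam; rw [coeff_mk]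

lemma coeff_Lam_mul (u v : ℕ → ℕ → ℚ) (n : ℕ) :
    coeff n (Lam u * Lam v) = ∑ p ∈ Qn n, u p.1 p.2.2.1 * v p.2.1 p.2.2.2 := by
  rw [coeff_mul]
  simp only [coeff_Lam, Finset.sum_mul_sum]
  simp only [← Finset.sum_product']
  rw [Finset.sum_sigma']
  refine Finset.sum_bij' (fun s _ => (s.2.1.1, s.2.2.1, s.2.1.2, s.2.2.2))
    (fun p _ => ⟨(p.1 * p.2.2.1, p.2.1 * p.2.2.2), ((p.1, p.2.2.1), (p.2.1, p.2.2.2))⟩)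
    ?_ ?_ ?_ ?_ ?_
  · rintro ⟨⟨i, j⟩, ⟨a, x⟩, ⟨b, y⟩⟩ h
    simp only [mem_sigma, HasAntidiagonal.mem_antidiagonal, mem_product, Nat.mem_divisorsAntidiagonal] at h
    obtain ⟨rfl, ⟨rfl, h1⟩, ⟨rfl, h2⟩⟩ := h
    rw [mem_Qn]
    refine ⟨⟨?_, ?_, ?_, ?_⟩, rfl⟩ <;> apply Nat.pos_of_ne_zero <;> rintro rfl <;> simp at h1 h2
  · rintro ⟨a, b, x, y⟩ h
    rw [mem_Qn] at h
    obtain ⟨⟨ha, hb, hx, hy⟩, rfl⟩ := h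
    simp only [mem_sigma, HasAntidiagonal.mem_antidiagonal, mem_product, Nat.mem_divisorsAntidiagonal]
    refine ⟨trivial, ⟨trivial, ?_⟩, ⟨trivial, ?_⟩⟩ <;> positivity
  · rintro ⟨⟨i, j⟩, ⟨a, x⟩, ⟨b, y⟩⟩ h
    simp only [mem_sigma, HasAntidiagonal.mem_antidiagonal, mem_product, Nat.mem_divisorsAntidiagonal] at h
    obtain ⟨rfl, ⟨rfl, h1⟩, ⟨rfl, h2⟩⟩ := h
    rfl
  · rintro ⟨a, b, x, y⟩ h; rfl
  · rintro ⟨⟨i, j⟩, ⟨a, x⟩, ⟨b, y⟩⟩ h; rfl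

lemma sum_Qn_swap (n : ℕ) (f : ℕ → ℕ → ℕ → ℕ → ℚ) :
    ∑ p ∈ Qn n, f p.1 p.2.1 p.2.2.1 p.2.2.2 = ∑ p ∈ Qn n, f p.2.1 p.1 p.2.2.2 p.2.2.1 := by
  refine Finset.sum_bij' (fun p _ => (p.2.1, p.1, p.2.2.2, p.2.2.1))
    (fun p _ => (p.2.1, p.1, p.2.2.2, p.2.2.1)) ?_ ?_ ?_ ?_ ?_
  · rintro ⟨a, b, x, y⟩ h; rw [mem_Qn] at *; dsimp only at *; exact ⟨by tauto, by omega⟩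
  · rintro ⟨a, b, x, y⟩ h; rw [mem_Qn] at *; dsimp only at *; exact ⟨by tauto, by omega⟩
  · rintro ⟨a, b, x, y⟩ h; rfl
  · rintro ⟨a, b, x, y⟩ h; rfl
  · rintro ⟨a, b, x, y⟩ h; rfl

lemma coeff_two_Lam_mul (u v : ℕ → ℕ → ℚ) (n : ℕ) :
    2 * coeff n (Lam u * Lam v) =
      ∑ p ∈ Qn n, (u p.1 p.2.2.1 * v p.2.1 p.2.2.2 + u p.2.1 p.2.2.2 * v p.1 p.2.2.1) := by
  rw [sum_add_distrib, coeff_Lam_mul, two_mul]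
  congr 1
  exact sum_Qn_swap n (fun a b x y => u a x * v b y)

/-- splitting a symmetric sum along `key` -/
lemma sum_split (n : ℕ) (f : ℕ → ℕ → ℕ → ℕ → ℚ) (k : ℕ → ℕ → ℕ)
    (hf : ∀ a b x y, f b a y x = f a b x y) (c : ℕ × ℕ × ℕ × ℕ → ℕ) (d : ℕ × ℕ × ℕ × ℕ → ℕ)
    (hcd : ∀ a b x y, c (b, a, y, x) = d (a, b, x, y)) :
    ∑ p ∈ Qn n, f p.1 p.2.1 p.2.2.1 p.2.2.2 =
      2 * ∑ p ∈ (Qn n).filter (fun p => d p < c p), f p.1 p.2.1 p.2.2.1 p.2.2.2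
      + ∑ p ∈ (Qn n).filter (fun p => c p = d p), f p.1 p.2.1 p.2.2.1 p.2.2.2 := by
  have hdc : ∀ a b x y, d (b, a, y, x) = c (a, b, x, y) := fun a b x y => (hcd b a y x).symm
  simp only [Finset.sum_filter, mul_sum, ← sum_add_distrib]
  have h1 : ∑ p ∈ Qn n, (if d p < c p then f p.1 p.2.1 p.2.2.1 p.2.2.2 else 0) =
      ∑ p ∈ Qn n, (if c p < d p then f p.1 p.2.1 p.2.2.1 p.2.2.2 else 0) := by
    have := sum_Qn_swap n (fun a b x y => if d (a, b, x, y) < c (a, b, x, y) then f a b x y else 0)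
    refine this.trans (sum_congr rfl ?_)
    rintro ⟨a, b, x, y⟩ _
    dsimp only
    rw [hf, hcd, hdc]
  rw [sum_add_distrib, ← mul_sum, two_mul]
  nth_rewrite 2 [h1]
  rw [← sum_add_distrib, ← sum_add_distrib]
  refine sum_congr rfl fun p _ => ?_
  rcases lt_trichotomy (c p) (d p) with h | h | h
  · rw [if_neg (by omega), if_pos h, if_neg (by omega)]; ring
  · rw [if_neg (by omega), if_neg (by omega), if_pos h]; ring
  · rw [if_pos (by omega), if_neg (by omega), if_neg (by omega)]; ring

/-- The basic function of the elliptic-function-type identity. -/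
def Tht (F : ℤ → ℤ → ℚ) (a b x y : ℕ) : ℚ :=
  (a : ℚ) * b * F (a + b) ((x : ℤ) - y) - b * (a + b) * F a y - a * (a + b) * F b x

def Tht' (F : ℤ → ℤ → ℚ) (a b x y : ℕ) : ℚ :=
  (a : ℚ) * (b - a) * F b x - (b - a) * b * F a y - a * b * F ((a : ℤ) - b) (x + y)

lemma sum_shift (F : ℤ → ℤ → ℚ) (he : ∀ c w, F (-c) w = F c w) (n : ℕ) :
    ∑ p ∈ (Qn n).filter (fun p => p.2.2.2 < p.2.2.1), Tht F p.1 p.2.1 p.2.2.1 p.2.2.2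
    = ∑ p ∈ (Qn n).filter (fun p => p.1 < p.2.1), Tht' F p.1 p.2.1 p.2.2.1 p.2.2.2 := by
  refine Finset.sum_bij' (fun p _ => (p.1, p.1 + p.2.1, p.2.2.1 - p.2.2.2, p.2.2.2))
    (fun p _ => (p.1, p.2.1 - p.1, p.2.2.1 + p.2.2.2, p.2.2.2)) ?_ ?_ ?_ ?_ ?_
  · rintro ⟨a, b, x, y⟩ h
    rw [mem_filter, mem_Qn] at *
    obtain ⟨⟨⟨ha, hb, hx, hy⟩, hn⟩, hl⟩ := h
    dsimp only at *
    obtain ⟨z, rfl⟩ := Nat.exists_eq_add_of_lt hl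
    refine ⟨⟨⟨ha, by omega, by omega, hy⟩, ?_⟩, by omega⟩
    rw [show y + z + 1 - y = z + 1 by omega, ← hn]; ring
  · rintro ⟨a, b, x, y⟩ h
    rw [mem_filter, mem_Qn] at *
    obtain ⟨⟨⟨ha, hb, hx, hy⟩, hn⟩, hl⟩ := h
    dsimp only at *
    obtain ⟨z, rfl⟩ := Nat.exists_eq_add_of_lt hl
    refine ⟨⟨⟨ha, by omega, by omega, hy⟩, ?_⟩, by omega⟩
    rw [show a + z + 1 - a = z + 1 by omega, ← hn]; ring
  · rintro ⟨a, b, x, y⟩ h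
    rw [mem_filter, mem_Qn] at h
    dsimp only at *
    simp only [Prod.mk.injEq]; refine ⟨trivial, ?_, ?_, trivial⟩ <;> omega
  · rintro ⟨a, b, x, y⟩ h
    rw [mem_filter, mem_Qn] at h
    dsimp only at *
    simp only [Prod.mk.injEq]; refine ⟨trivial, ?_, ?_, trivial⟩ <;> omega
  · rintro ⟨a, b, x, y⟩ h
    rw [mem_filter, mem_Qn] at h
    dsimp only at *
    unfold Tht Tht'
    rw [Nat.cast_sub h.2.le]
    have e : (a : ℤ) - ((a + b : ℕ) : ℤ) = -(b : ℤ) := by push_cast; ring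
    rw [e, he]
    push_cast
    rw [sub_add_cancel]
    ring

lemma master1 (F : ℤ → ℤ → ℚ) (he : ∀ c w, F (-c) w = F c w) (ho : ∀ c w, F c (-w) = F c w) (n : ℕ) :
    ∑ p ∈ Qn n, ((p.1 : ℚ) * p.2.1 * (F ((p.1 : ℤ) + p.2.1) ((p.2.2.1 : ℤ) - p.2.2.2)
      + F ((p.1 : ℤ) - p.2.1) ((p.2.2.1 : ℤ) + p.2.2.2) - 2 * F p.1 p.2.2.2 - 2 * F p.2.1 p.2.2.1))
    = ∑ p ∈ (Qn n).filter (fun p => p.2.2.1 = p.2.2.2), Tht F p.1 p.2.1 p.2.2.1 p.2.2.2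
      - ∑ p ∈ (Qn n).filter (fun p => p.2.1 = p.1), Tht' F p.1 p.2.1 p.2.2.1 p.2.2.2 := by
  have h1 := sum_split n (Tht F) (fun a _ => a) (by
    intro a b x y; unfold Tht
    rw [← ho _ ((y : ℤ) - x), neg_sub, add_comm (b : ℤ)]; ring)
    (fun p => p.2.2.1) (fun p => p.2.2.2) (by intros; rfl)
  have h2 := sum_split n (Tht' F) (fun a _ => a) (by
    intro a b x y; unfold Tht'
    rw [← he ((b : ℤ) - a), neg_sub, add_comm (y : ℤ)]; ring)
    (fun p => p.2.1) (fun p => p.1) (by intros; rfl)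
  have h3 := sum_shift F he n
  have h4 : ∑ p ∈ Qn n, ((p.1 : ℚ) * p.2.1 * (F ((p.1 : ℤ) + p.2.1) ((p.2.2.1 : ℤ) - p.2.2.2)
      + F ((p.1 : ℤ) - p.2.1) ((p.2.2.1 : ℤ) + p.2.2.2) - 2 * F p.1 p.2.2.2 - 2 * F p.2.1 p.2.2.1))
      = ∑ p ∈ Qn n, Tht F p.1 p.2.1 p.2.2.1 p.2.2.2 - ∑ p ∈ Qn n, Tht' F p.1 p.2.1 p.2.2.1 p.2.2.2 := by
    rw [← sum_sub_distrib]
    refine sum_congr rfl fun p _ => ?_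
    unfold Tht Tht'
    ring
  rw [h4, h1, h2, h3]; ring

lemma diag_x (n : ℕ) (f : ℕ → ℕ → ℕ → ℕ → ℚ) :
    ∑ p ∈ (Qn n).filter (fun p => p.2.2.1 = p.2.2.2), f p.1 p.2.1 p.2.2.1 p.2.2.2
    = ∑ p ∈ n.divisorsAntidiagonal, ∑ a ∈ Finset.Ico 1 p.1, f a (p.1 - a) p.2 p.2 := by
  rw [Finset.sum_sigma']
  refine Finset.sum_bij' (fun p _ => ⟨(p.1 + p.2.1, p.2.2.1), p.1⟩)
    (fun s _ => (s.2, s.1.1 - s.2, s.1.2, s.1.2)) ?_ ?_ ?_ ?_ ?_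
  · rintro ⟨a, b, x, y⟩ h
    rw [mem_filter, mem_Qn] at h
    obtain ⟨⟨⟨ha, hb, hx, hy⟩, rfl⟩, hl⟩ := h
    dsimp only at *
    subst hl
    simp only [mem_sigma, Nat.mem_divisorsAntidiagonal, mem_Ico]
    refine ⟨⟨by ring, by positivity⟩, by omega, by omega⟩
  · rintro ⟨⟨m, x⟩, a⟩ h
    simp only [mem_sigma, Nat.mem_divisorsAntidiagonal, mem_Ico] at h
    obtain ⟨⟨rfl, h0⟩, h1, h2⟩ := h
    rw [mem_filter, mem_Qn]
    obtain ⟨z, rfl⟩ := Nat.exists_eq_add_of_lt h2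
    have hx : 0 < x := by apply Nat.pos_of_ne_zero; rintro rfl; simp at h0
    dsimp only
    refine ⟨⟨⟨by omega, by omega, hx, hx⟩, ?_⟩, rfl⟩
    rw [show a + z + 1 - a = z + 1 by omega]; ring
  · rintro ⟨a, b, x, y⟩ h
    rw [mem_filter, mem_Qn] at h
    dsimp only at *
    simp only [Prod.mk.injEq]; refine ⟨trivial, ?_, trivial, ?_⟩ <;> omega
  · rintro ⟨⟨m, x⟩, a⟩ h
    simp only [mem_sigma, Nat.mem_divisorsAntidiagonal, mem_Ico] at h
    dsimp only
    rw [show a + (m - a) = m by omega]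
  · rintro ⟨a, b, x, y⟩ h
    rw [mem_filter, mem_Qn] at h
    dsimp only at *
    rw [show a + b - a = b by omega, h.2]

lemma diag_a (n : ℕ) (f : ℕ → ℕ → ℕ → ℕ → ℚ) :
    ∑ p ∈ (Qn n).filter (fun p => p.2.1 = p.1), f p.1 p.2.1 p.2.2.1 p.2.2.2
    = ∑ p ∈ n.divisorsAntidiagonal, ∑ x ∈ Finset.Ico 1 p.2, f p.1 p.1 x (p.2 - x) := by
  rw [Finset.sum_sigma']
  refine Finset.sum_bij' (fun p _ => ⟨(p.1, p.2.2.1 + p.2.2.2), p.2.2.1⟩)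
    (fun s _ => (s.1.1, s.1.1, s.2, s.1.2 - s.2)) ?_ ?_ ?_ ?_ ?_
  · rintro ⟨a, b, x, y⟩ h
    rw [mem_filter, mem_Qn] at h
    obtain ⟨⟨⟨ha, hb, hx, hy⟩, rfl⟩, hl⟩ := h
    dsimp only at *
    subst hl
    simp only [mem_sigma, Nat.mem_divisorsAntidiagonal, mem_Ico]
    refine ⟨⟨by ring, by positivity⟩, by omega, by omega⟩
  · rintro ⟨⟨x, m⟩, a⟩ h
    simp only [mem_sigma, Nat.mem_divisorsAntidiagonal, mem_Ico] at h
    obtain ⟨⟨rfl, h0⟩, h1, h2⟩ := h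
    rw [mem_filter, mem_Qn]
    obtain ⟨z, rfl⟩ := Nat.exists_eq_add_of_lt h2
    have hx : 0 < x := by apply Nat.pos_of_ne_zero; rintro rfl; simp at h0
    dsimp only
    refine ⟨⟨⟨hx, hx, by omega, by omega⟩, ?_⟩, rfl⟩
    rw [show a + z + 1 - a = z + 1 by omega]; ring
  · rintro ⟨a, b, x, y⟩ h
    rw [mem_filter, mem_Qn] at h
    dsimp only at *
    simp only [Prod.mk.injEq]; refine ⟨trivial, ?_, trivial, ?_⟩ <;> omega
  · rintro ⟨⟨x, m⟩, a⟩ h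
    simp only [mem_sigma, Nat.mem_divisorsAntidiagonal, mem_Ico] at h
    dsimp only
    rw [show a + (m - a) = m by omega]
  · rintro ⟨a, b, x, y⟩ h
    rw [mem_filter, mem_Qn] at h
    dsimp only at *
    rw [show x + y - x = y by omega, h.2]

lemma dsum (f P R : ℕ → ℚ) (hP0 : P 0 = 0) (hP : ∀ m, P (m + 1) = P m + f (m + 1))
    (hR1 : R 1 = 0) (hR : ∀ m, 1 ≤ m → R (m + 1) = R m + P m) (m : ℕ) (hm : 1 ≤ m) :
    ∑ a ∈ Finset.Ico 1 m, ((m : ℚ) - a) * f a = R m := by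
  have hS : ∀ m, ∑ a ∈ Finset.Ico 1 (m + 1), f a = P m := by
    intro m
    induction m with
    | zero => simp [hP0]
    | succ m ih => rw [Finset.sum_Ico_succ_top (by omega), ih, hP]
  induction m, hm using Nat.le_induction with
  | base => simp [hR1]
  | succ m hm ih =>
    rw [hR m hm, ← ih, ← hS m, Finset.sum_Ico_succ_top hm, Finset.sum_Ico_succ_top hm, ← add_assoc,
      ← sum_add_distrib]
    congr 1
    · refine sum_congr rfl fun a _ => ?_
      push_cast; ring
    · push_cast; ring

lemma sum_a_mul (m : ℕ) (hm : 1 ≤ m) :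
    ∑ a ∈ Finset.Ico 1 m, ((m : ℚ) - a) * a = ((m : ℚ) ^ 3 - m) / 6 :=
  dsum (fun a => (a : ℚ)) (fun m => (m : ℚ) * (m + 1) / 2) (fun m => ((m : ℚ) ^ 3 - m) / 6)
    (by norm_num) (by intro m; push_cast; ring) (by norm_num) (by intro m _; push_cast; ring) m hm

lemma sum_a_one (m : ℕ) (hm : 1 ≤ m) :
    ∑ a ∈ Finset.Ico 1 m, ((m : ℚ) - a) * 1 = (m : ℚ) * (m - 1) / 2 :=
  dsum (fun a => 1) (fun m => (m : ℚ)) (fun m => (m : ℚ) * (m - 1) / 2)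
    (by norm_num) (by intro m; push_cast; ring) (by norm_num) (by intro m _; push_cast; ring) m hm

lemma sum_a_sg (m : ℕ) (hm : 1 ≤ m) :
    ∑ a ∈ Finset.Ico 1 m, ((m : ℚ) - a) * sg (a : ℤ) = - (m / 2 - (1 - sg (m : ℤ)) / 4) :=
  dsum (fun a => sg (a : ℤ)) (fun m => (sg (m : ℤ) - 1) / 2)
    (fun m => - ((m : ℚ) / 2 - (1 - sg (m : ℤ)) / 4))
    (by simp [sg]) (by intro m; simp only [sg_nat]; ring) (by simp only [sg_nat]; norm_num)
    (by intro m _; simp only [sg_nat]; push_cast; ring) m hm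

lemma master (F : ℤ → ℤ → ℚ) (he : ∀ c w, F (-c) w = F c w) (ho : ∀ c w, F c (-w) = F c w) (n : ℕ) :
    ∑ p ∈ Qn n, ((p.1 : ℚ) * p.2.1 * (F ((p.1 : ℤ) + p.2.1) ((p.2.2.1 : ℤ) - p.2.2.2)
      + F ((p.1 : ℤ) - p.2.1) ((p.2.2.1 : ℤ) + p.2.2.2) - 2 * F p.1 p.2.2.2 - 2 * F p.2.1 p.2.2.1))
    = ∑ p ∈ n.divisorsAntidiagonal, (((p.1 : ℚ) ^ 3 - p.1) / 6 * F p.1 0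
        - 2 * p.1 * ∑ a ∈ Finset.Ico 1 p.1, ((p.1 : ℚ) - a) * F a p.2
        + ((p.2 : ℚ) - 1) * p.1 ^ 2 * F 0 p.2) := by
  rw [master1 F he ho, diag_x, diag_a, ← sum_sub_distrib]
  refine sum_congr rfl ?_
  rintro ⟨m, x⟩ hp
  rw [Nat.mem_divisorsAntidiagonal] at hp
  dsimp only at *
  obtain ⟨rfl, h0⟩ := hp
  have hm : 1 ≤ m := by apply Nat.pos_of_ne_zero; rintro rfl; simp at h0
  have hx : 1 ≤ x := by apply Nat.pos_of_ne_zero; rintro rfl; simp at h0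
  have e1 : ∑ y ∈ Finset.Ico 1 x, Tht' F m m y (x - y) = - (((x : ℚ) - 1) * m ^ 2 * F 0 x) := by
    have : ∀ y ∈ Finset.Ico 1 x, Tht' F m m y (x - y) = - (m ^ 2 * F 0 x) := by
      intro y hy
      rw [mem_Ico] at hy
      unfold Tht'
      rw [Nat.cast_sub hy.2.le, sub_self, sub_self, add_sub_cancel]
      ring
    rw [sum_congr rfl this, sum_const, Nat.card_Ico, nsmul_eq_mul, Nat.cast_sub hx]
    push_cast; ring
  have e2 : ∑ a ∈ Finset.Ico 1 m, Tht F a (m - a) x x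
      = ∑ a ∈ Finset.Ico 1 m, (((m : ℚ) - a) * a * F m 0) - ∑ a ∈ Finset.Ico 1 m, m * (((m : ℚ) - a) * F a x)
        - ∑ a ∈ Finset.Ico 1 m, m * (((m : ℚ) - (m - a : ℕ)) * F (m - a : ℕ) x) := by
    rw [← sum_sub_distrib, ← sum_sub_distrib]
    refine sum_congr rfl fun a ha => ?_
    rw [mem_Ico] at ha
    unfold Tht
    rw [Nat.cast_sub ha.2.le, Nat.cast_sub ha.2.le, add_sub_cancel, sub_self]
    ring
  have e3 : ∑ a ∈ Finset.Ico 1 m, m * (((m : ℚ) - (m - a : ℕ)) * F (m - a : ℕ) x)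
      = ∑ a ∈ Finset.Ico 1 m, m * (((m : ℚ) - a) * F a x) := by
    refine Finset.sum_bij' (fun a _ => m - a) (fun a _ => m - a) ?_ ?_ ?_ ?_ ?_
    · intro a ha; rw [mem_Ico] at *; omega
    · intro a ha; rw [mem_Ico] at *; omega
    · intro a ha; rw [mem_Ico] at *; omega
    · intro a ha; rw [mem_Ico] at *; omega
    · intro a ha; rfl
  rw [e1, e2, e3, ← sum_mul, sum_a_mul m hm, ← mul_sum]
  ring

end RF8

namespace RF8
open PowerSeries

def ch (z : ℤ) : ℚ := ((ZMod.χ₈ (z : ZMod 8) : ℤ) : ℚ)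

def g8 (z : ZMod 8) : ℤ := if z = 0 then 2 else if z = 4 then -2 else 0

def gg (z : ℤ) : ℚ := ((g8 (z : ZMod 8) : ℤ) : ℚ)

lemma ch_add (x y : ℤ) : ch (x + y) + ch (x - y) = ch x * gg y + gg x * ch y := by
  unfold ch gg
  have : ∀ x y : ZMod 8, ZMod.χ₈ (x + y) + ZMod.χ₈ (x - y) = ZMod.χ₈ x * g8 y + g8 x * ZMod.χ₈ y := by
    decide
  exact_mod_cast this (x : ZMod 8) (y : ZMod 8)

lemma ch_neg (x : ℤ) : ch (-x) = ch x := by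
  unfold ch
  have : ∀ x : ZMod 8, ZMod.χ₈ (-x) = ZMod.χ₈ x := by decide
  push_cast; rw [this]

lemma ch_zero : ch 0 = 0 := by
  unfold ch; simp

lemma sg_neg (x : ℤ) : sg (-x) = sg x := by simp only [sg, even_neg]

lemma sg_zero : sg 0 = 1 := by simp [sg]

lemma gg_eq (n : ℕ) : gg (n : ℤ) = -2 * (if 4 ∣ n then 1 else 0) + 4 * (if 8 ∣ n then 1 else 0) := by
  have e : ((n : ℤ) : ZMod 8) = ((n % 8 : ℕ) : ZMod 8) := by simp
  have h4 : (4 ∣ n) ↔ (4 ∣ n % 8) := by omega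
  have h8 : (8 ∣ n) ↔ (8 ∣ n % 8) := by omega
  unfold gg
  rw [e]
  simp only [h4, h8]
  have : n % 8 < 8 := Nat.mod_lt _ (by norm_num)
  generalize n % 8 = r at *
  interval_cases r <;> simp [g8] <;> (try norm_num) <;> (try decide)

/-- parity of arguments where the character is nonzero -/
lemma ch_sg (a x : ℕ) : ch (a : ℤ) * sg (x : ℤ) = (-1) ^ (a * x) * ch (a : ℤ) := by
  rcases Nat.even_or_odd a with ha | ha
  · have : ch (a : ℤ) = 0 := by
      unfold ch
      have h2 : ∀ z : ZMod 8, ZMod.χ₈ (2 * z) = 0 := by decide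
      obtain ⟨k, rfl⟩ := ha
      have := h2 (k : ZMod 8)
      rw [← two_mul]; push_cast; rw [this]; norm_num
    rw [this]; ring
  · rw [sg_nat, pow_mul, ha.neg_one_pow]; ring

lemma sum_a_ch (m : ℕ) (hm : 1 ≤ m) :
    ∑ a ∈ Finset.Ico 1 m, ((m : ℚ) - a) * ch (a : ℤ) = 1 - ch (m : ℤ) - gg (m : ℤ) / 2 := by
  refine dsum (fun a => ch (a : ℤ))
    (fun m => - ch ((m + 1 : ℕ) : ℤ) + ch (m : ℤ) - (gg ((m + 1 : ℕ) : ℤ) - gg (m : ℤ)) / 2)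
    (fun m => 1 - ch (m : ℤ) - gg (m : ℤ) / 2) ?_ ?_ ?_ ?_ m hm
  · have e1 : ch 1 = 1 := by unfold ch; simp
    have e2 : gg 1 = 0 := by unfold gg; norm_cast
    have e3 : gg 0 = 2 := by unfold gg; norm_cast
    push_cast
    rw [e1, ch_zero, e2, e3]; norm_num
  · intro m
    have h2 : ∀ z : ZMod 8, 2 * (- ZMod.χ₈ (z + 1 + 1) + ZMod.χ₈ (z + 1)) - (g8 (z + 1 + 1) - g8 (z + 1))
        = 2 * (- ZMod.χ₈ (z + 1) + ZMod.χ₈ z) - (g8 (z + 1) - g8 z) + 2 * ZMod.χ₈ (z + 1) := by decide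
    have h3 := h2 (m : ZMod 8)
    have h4 : (2 : ℚ) * (- ch ((m + 1 + 1 : ℕ) : ℤ) + ch ((m + 1 : ℕ) : ℤ))
        - (gg ((m + 1 + 1 : ℕ) : ℤ) - gg ((m + 1 : ℕ) : ℤ))
        = 2 * (- ch ((m + 1 : ℕ) : ℤ) + ch (m : ℤ)) - (gg ((m + 1 : ℕ) : ℤ) - gg (m : ℤ))
          + 2 * ch ((m + 1 : ℕ) : ℤ) := by
      unfold ch gg
      push_cast
      exact_mod_cast h3
    linarith
  · have e1 : ch 1 = 1 := by unfold ch; simp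
    have e2 : gg 1 = 0 := by unfold gg; norm_cast
    push_cast
    rw [e1, e2]; norm_num
  · intro m _; ring

lemma Lam_ext {u v : ℕ → ℕ → ℚ} (H : ∀ a x, u a x = v a x) : Lam u = Lam v := by
  congr 1; funext a x; exact H a x

lemma Lam_add (u v : ℕ → ℕ → ℚ) : Lam (fun a x => u a x + v a x) = Lam u + Lam v := by
  ext n; simp only [map_add, coeff_Lam, sum_add_distrib]

lemma Lam_smul (c : ℚ) (u : ℕ → ℕ → ℚ) : Lam (fun a x => c * u a x) = C c * Lam u := by
  ext n; simp only [coeff_C_mul, coeff_Lam, mul_sum]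

lemma Lam_swap (u : ℕ → ℕ → ℚ) : Lam (fun a x => u x a) = Lam u := by
  ext n; simp only [coeff_Lam]
  refine Finset.sum_bij' (fun p _ => p.swap) (fun p _ => p.swap) ?_ ?_ ?_ ?_ ?_
  · intro p hp; rwa [Nat.swap_mem_divisorsAntidiagonal]
  · intro p hp; rwa [Nat.swap_mem_divisorsAntidiagonal]
  · intro p hp; rfl
  · intro p hp; rfl
  · intro p hp; rfl

lemma Lam_ex_x (k : ℕ) [NeZero k] (u : ℕ → ℕ → ℚ) :
    Lam (fun a x => if k ∣ x then u a (x / k) else 0) = ex k (Lam u) := by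
  have hk : 0 < k := Nat.pos_of_ne_zero (NeZero.ne k)
  ext n
  rw [coeff_ex]
  simp only [coeff_Lam]
  split_ifs with h
  · obtain ⟨m, rfl⟩ := h
    rw [Nat.mul_div_cancel_left _ hk, ← Finset.sum_filter]
    refine Finset.sum_bij' (fun p _ => (p.1, p.2 / k)) (fun p _ => (p.1, k * p.2)) ?_ ?_ ?_ ?_ ?_
    · rintro ⟨a, x⟩ h
      rw [mem_filter, Nat.mem_divisorsAntidiagonal] at h
      obtain ⟨⟨h1, h2⟩, y, rfl⟩ := h
      rw [Nat.mem_divisorsAntidiagonal]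
      dsimp only at *
      rw [Nat.mul_div_cancel_left _ hk]
      refine ⟨Nat.eq_of_mul_eq_mul_left hk (by rw [← h1]; ring), ?_⟩
      rintro rfl; simp at h2
    · rintro ⟨a, x⟩ h
      rw [Nat.mem_divisorsAntidiagonal] at h
      rw [mem_filter, Nat.mem_divisorsAntidiagonal]
      dsimp only at *
      refine ⟨⟨by rw [← h.1]; ring, ?_⟩, Dvd.intro _ rfl⟩
      exact mul_ne_zero hk.ne' h.2
    · rintro ⟨a, x⟩ h
      rw [mem_filter] at h
      dsimp only at *
      rw [Nat.mul_div_cancel' h.2]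
    · rintro ⟨a, x⟩ h
      dsimp only at *
      rw [Nat.mul_div_cancel_left _ hk]
    · rintro ⟨a, x⟩ h; rfl
  · refine Finset.sum_eq_zero ?_
    rintro ⟨a, x⟩ hp
    rw [Nat.mem_divisorsAntidiagonal] at hp
    rw [if_neg]
    rintro hx; apply h; rw [← hp.1]; exact Dvd.dvd.mul_left hx a

lemma Lam_ex_a (k : ℕ) [NeZero k] (u : ℕ → ℕ → ℚ) :
    Lam (fun a x => if k ∣ a then u (a / k) x else 0) = ex k (Lam u) := by
  rw [← Lam_swap u, ← Lam_ex_x, ← Lam_swap]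

noncomputable def K1 : ℚ⟦X⟧ := Lam (fun a x => a * ch x)
noncomputable def K2 : ℚ⟦X⟧ := Lam (fun a _ => a * ch a)
noncomputable def E1 : ℚ⟦X⟧ := Lam (fun a x => a ^ 3 * ch x)
noncomputable def E2 : ℚ⟦X⟧ := Lam (fun a _ => a ^ 3 * ch a)

lemma Lam_ng (u v : ℕ → ℕ → ℚ) (H : ∀ a x, v a x = (-1) ^ (a * x) * u a x) : Lam v = ng (Lam u) := by
  ext n
  rw [coeff_ng, coeff_Lam, coeff_Lam, mul_sum]
  refine sum_congr rfl fun p hp => ?_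
  rw [Nat.mem_divisorsAntidiagonal] at hp
  rw [H, hp.1]

lemma Lam_DD (u v : ℕ → ℕ → ℚ) (H : ∀ a x, v a x = (a * x) * u a x) : Lam v = DD (Lam u) := by
  ext n
  rw [coeff_DD, coeff_Lam, coeff_Lam, mul_sum]
  refine sum_congr rfl fun p hp => ?_
  rw [Nat.mem_divisorsAntidiagonal] at hp
  rw [H, ← hp.1]; push_cast; ring

lemma ngK1 : Lam (fun a x => a * sg a * ch x) = ng K1 :=
  Lam_ng _ _ (fun a x => by rw [mul_comm a x]; linear_combination (a : ℚ) * ch_sg x a)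

lemma ngK2 : Lam (fun a x => a * ch a * sg x) = ng K2 :=
  Lam_ng _ _ (fun a x => by linear_combination (a : ℚ) * ch_sg a x)

/-- `∑ b (2 - g(y)) q^{by}` -/
lemma L_eq : Lam (fun b y => b * (2 - gg y)) = 2 * S + 2 * S4 - 4 * S8 := by
  have e : ∀ b y : ℕ, (b : ℚ) * (2 - gg y) = 2 * (b : ℚ) + (2 * (if 4 ∣ y then (b : ℚ) else 0)
      + (-4) * (if 8 ∣ y then (b : ℚ) else 0)) := by
    intro b y; rw [gg_eq]; split_ifs <;> ring
  rw [Lam_ext e, Lam_add, Lam_add, Lam_smul, Lam_smul, Lam_smul, Lam_ex_x 4 (fun a _ => (a : ℚ)),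
    Lam_ex_x 8 (fun a _ => (a : ℚ)), map_neg, map_ofNat, map_ofNat]
  change 2 * S + (2 * S4 + -4 * S8) = _
  ring

lemma M_eq : Lam (fun b _ => b * (2 - gg b)) = 2 * S + 8 * S4 - 32 * S8 := by
  have e : ∀ b y : ℕ, (b : ℚ) * (2 - gg b) = 2 * (b : ℚ) + (8 * (if 4 ∣ b then ((b / 4 : ℕ) : ℚ) else 0)
      + (-32) * (if 8 ∣ b then ((b / 8 : ℕ) : ℚ) else 0)) := by
    intro b y; rw [gg_eq]
    by_cases h8 : 8 ∣ b
    · obtain ⟨c, rfl⟩ := h8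
      have h4 : 4 ∣ 8 * c := by omega
      rw [if_pos h4, if_pos (Dvd.intro _ rfl), if_pos h4, if_pos (Dvd.intro _ rfl),
        show 8 * c / 4 = 2 * c by omega, show 8 * c / 8 = c by omega]
      push_cast; ring
    · by_cases h4 : 4 ∣ b
      · obtain ⟨c, rfl⟩ := h4
        rw [if_pos (Dvd.intro _ rfl), if_neg h8, if_neg h8, if_pos (Dvd.intro _ rfl),
          show 4 * c / 4 = c by omega]
        push_cast; ring
      · rw [if_neg h4, if_neg h8, if_neg h8, if_neg h4]; ring
  rw [Lam_ext e, Lam_add, Lam_add, Lam_smul, Lam_smul, Lam_smul, Lam_ex_a 4 (fun a _ => (a : ℚ)),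
    Lam_ex_a 8 (fun a _ => (a : ℚ)), map_neg, map_ofNat, map_ofNat, map_ofNat]
  change 2 * S + (8 * S4 + -32 * S8) = _
  ring

lemma sg_eq (n : ℕ) : sg (n : ℤ) = -1 + 2 * (if 2 ∣ n then 1 else 0) := by
  unfold sg
  have e : Even (n : ℤ) ↔ 2 ∣ n := by rw [Int.even_coe_nat, even_iff_two_dvd]
  by_cases h : 2 ∣ n
  · rw [if_pos (e.2 h), if_pos h]; norm_num
  · rw [if_neg (fun h' => h (e.1 h')), if_neg h]; norm_num

noncomputable def Lm : ℚ⟦X⟧ := Lam (fun b _ => b * sg b)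
noncomputable def Mm : ℚ⟦X⟧ := Lam (fun b y => b * sg y)

lemma Lm_eq : Lm = -S + 4 * S2 := by
  have e : ∀ b y : ℕ, (b : ℚ) * sg b = (-1) * (b : ℚ) + 4 * (if 2 ∣ b then ((b / 2 : ℕ) : ℚ) else 0) := by
    intro b y; rw [sg_eq]
    by_cases h2 : 2 ∣ b
    · obtain ⟨c, rfl⟩ := h2
      rw [if_pos (Dvd.intro _ rfl), if_pos (Dvd.intro _ rfl), show 2 * c / 2 = c by omega]
      push_cast; ring
    · rw [if_neg h2, if_neg h2]; ring
  unfold Lm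
  rw [Lam_ext e, Lam_add, Lam_smul, Lam_smul, Lam_ex_a 2 (fun a _ => (a : ℚ)), map_neg, map_one, map_ofNat]
  change -1 * S + 4 * S2 = _
  ring

lemma Mm_eq : Mm = -S + 2 * S2 := by
  have e : ∀ b y : ℕ, (b : ℚ) * sg y = (-1) * (b : ℚ) + 2 * (if 2 ∣ y then (b : ℚ) else 0) := by
    intro b y; rw [sg_eq]; split_ifs <;> ring
  unfold Mm
  rw [Lam_ext e, Lam_add, Lam_smul, Lam_smul, Lam_ex_x 2 (fun a _ => (a : ℚ)), map_neg, map_one, map_ofNat]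
  change -1 * S + 2 * S2 = _
  ring

lemma Lgm_eq : Lam (fun b y => b * sg b * gg y) = -2 * ex 4 Lm + 4 * ex 8 Lm := by
  have e : ∀ b y : ℕ, (b : ℚ) * sg b * gg y = (-2) * (if 4 ∣ y then (b : ℚ) * sg b else 0)
      + 4 * (if 8 ∣ y then (b : ℚ) * sg b else 0) := by
    intro b y; rw [gg_eq]; split_ifs <;> ring
  rw [Lam_ext e, Lam_add, Lam_smul, Lam_smul, Lam_ex_x 4 (fun b _ => (b : ℚ) * sg b),
    Lam_ex_x 8 (fun b _ => (b : ℚ) * sg b), map_neg, map_ofNat, map_ofNat]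
  rfl

lemma Mgm_eq : Lam (fun b y => b * gg b * sg y) = -8 * ex 4 Mm + 32 * ex 8 Mm := by
  have e : ∀ b y : ℕ, (b : ℚ) * gg b * sg y = (-8) * (if 4 ∣ b then ((b / 4 : ℕ) : ℚ) * sg y else 0)
      + 32 * (if 8 ∣ b then ((b / 8 : ℕ) : ℚ) * sg y else 0) := by
    intro b y; rw [gg_eq]
    by_cases h8 : 8 ∣ b
    · obtain ⟨c, rfl⟩ := h8
      have h4 : 4 ∣ 8 * c := by omega
      rw [if_pos h4, if_pos (Dvd.intro _ rfl), if_pos h4, if_pos (Dvd.intro _ rfl),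
        show 8 * c / 4 = 2 * c by omega, show 8 * c / 8 = c by omega]
      push_cast; ring
    · by_cases h4 : 4 ∣ b
      · obtain ⟨c, rfl⟩ := h4
        rw [if_pos (Dvd.intro _ rfl), if_neg h8, if_neg h8, if_pos (Dvd.intro _ rfl),
          show 4 * c / 4 = c by omega]
        push_cast; ring
      · rw [if_neg h4, if_neg h8, if_neg h8, if_neg h4]; ring
  rw [Lam_ext e, Lam_add, Lam_smul, Lam_smul, Lam_ex_a 4 (fun b y => (b : ℚ) * sg y),
    Lam_ex_a 8 (fun b y => (b : ℚ) * sg y), map_neg, map_ofNat, map_ofNat]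
  rfl

lemma I1 : E1 = DD K1 + 2 * K1 * (2 * S + 2 * S4 - 4 * S8) := by
  have hd : Lam (fun a x => (a : ℚ) ^ 2 * x * ch x) = DD K1 := Lam_DD _ _ (fun a x => by ring)
  rw [← L_eq, ← hd]
  ext n
  rw [mul_assoc, map_add, show (2 : ℚ⟦X⟧) = C (2 : ℚ) from (map_ofNat C 2).symm, coeff_C_mul]
  unfold K1
  rw [coeff_two_Lam_mul]
  have hm := master (fun _ w => ch w) (fun _ _ => rfl) (fun _ w => ch_neg w) n
  have e1 : ∑ p ∈ Qn n, ((p.1 : ℚ) * p.2.1 * (ch ((p.2.2.1 : ℤ) - p.2.2.2)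
      + ch ((p.2.2.1 : ℤ) + p.2.2.2) - 2 * ch p.2.2.2 - 2 * ch p.2.2.1))
      = - ∑ p ∈ Qn n, ((p.1 : ℚ) * ch p.2.2.1 * (p.2.1 * (2 - gg p.2.2.2))
        + p.2.1 * ch p.2.2.2 * (p.1 * (2 - gg p.2.2.1))) := by
    rw [← sum_neg_distrib]
    refine sum_congr rfl fun p _ => ?_
    linear_combination (p.1 : ℚ) * p.2.1 * ch_add (p.2.2.1 : ℤ) p.2.2.2
  rw [e1] at hm
  rw [neg_eq_iff_eq_neg.1 hm]
  unfold E1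
  rw [coeff_Lam, coeff_Lam, ← sub_eq_iff_eq_add', ← sum_sub_distrib, ← sum_neg_distrib]
  refine sum_congr rfl fun p hp => ?_
  rw [Nat.mem_divisorsAntidiagonal] at hp
  have h1 : 1 ≤ p.1 := by
    apply Nat.pos_of_ne_zero; intro h; rw [h, zero_mul] at hp; exact hp.2 hp.1.symm
  have hs := sum_a_one p.1 h1
  simp only [mul_one] at hs
  rw [← sum_mul, hs, ch_zero]
  ring

lemma I2 : 2 * DD K1 = K1 - ng K1 + 4 * ng K1 * (-2 * ex 4 Lm + 4 * ex 8 Lm) - 8 * K1 * Lm := by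
  have hd : Lam (fun a x => (a : ℚ) ^ 2 * x * ch x) = DD K1 := Lam_DD _ _ (fun a x => by ring)
  rw [← Lgm_eq, ← hd, ← ngK1]
  ext n
  have hm := master (fun c w => sg c * ch w) (fun c _ => by rw [sg_neg]) (fun _ w => by rw [ch_neg]) n
  have e1 : ∑ p ∈ Qn n, ((p.1 : ℚ) * p.2.1 * (sg ((p.1 : ℤ) + p.2.1) * ch ((p.2.2.1 : ℤ) - p.2.2.2)
      + sg ((p.1 : ℤ) - p.2.1) * ch ((p.2.2.1 : ℤ) + p.2.2.2) - 2 * (sg p.1 * ch p.2.2.2)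
      - 2 * (sg p.2.1 * ch p.2.2.1)))
      = ∑ p ∈ Qn n, ((p.1 : ℚ) * sg p.1 * ch p.2.2.1 * (p.2.1 * sg p.2.1 * gg p.2.2.2)
        + p.2.1 * sg p.2.1 * ch p.2.2.2 * (p.1 * sg p.1 * gg p.2.2.1))
       - 2 * ∑ p ∈ Qn n, ((p.1 : ℚ) * ch p.2.2.1 * (p.2.1 * sg p.2.1)
         + p.2.1 * ch p.2.2.2 * (p.1 * sg p.1)) := by
    rw [mul_sum, ← sum_sub_distrib]
    refine sum_congr rfl fun p _ => ?_
    rw [sg_add, sg_sub]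
    linear_combination (p.1 : ℚ) * p.2.1 * sg p.1 * sg p.2.1 * ch_add (p.2.2.1 : ℤ) p.2.2.2
  rw [e1, ← coeff_two_Lam_mul (fun a x => (a : ℚ) * sg a * ch x) (fun b y => (b : ℚ) * sg b * gg y),
    ← coeff_two_Lam_mul (fun a x => (a : ℚ) * ch x) (fun b y => (b : ℚ) * sg b)] at hm
  rw [show (2 : ℚ⟦X⟧) = C (2 : ℚ) from (map_ofNat C 2).symm,
    show (4 : ℚ⟦X⟧) = C (4 : ℚ) from (map_ofNat C 4).symm,
    show (8 : ℚ⟦X⟧) = C (8 : ℚ) from (map_ofNat C 8).symm, map_sub, map_add, map_sub,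
    mul_assoc (C (4 : ℚ)), mul_assoc (C (8 : ℚ)), coeff_C_mul, coeff_C_mul, coeff_C_mul]
  have e2 : 2 * coeff n (Lam (fun a x => (a : ℚ) ^ 2 * x * ch x)) - coeff n K1
      + coeff n (Lam (fun a x => (a : ℚ) * sg a * ch x)) = 2 * ∑ p ∈ n.divisorsAntidiagonal,
      (((p.1 : ℚ) ^ 3 - p.1) / 6 * (sg p.1 * ch 0)
        - 2 * p.1 * ∑ a ∈ Finset.Ico 1 p.1, ((p.1 : ℚ) - a) * (sg a * ch p.2)
        + ((p.2 : ℚ) - 1) * p.1 ^ 2 * (sg 0 * ch p.2)) := by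
    unfold K1
    simp only [coeff_Lam, mul_sum]
    rw [← sum_sub_distrib, ← sum_add_distrib]
    refine sum_congr rfl fun p hp => ?_
    rw [Nat.mem_divisorsAntidiagonal] at hp
    have h1 : 1 ≤ p.1 := by
      apply Nat.pos_of_ne_zero; intro h; rw [h, zero_mul] at hp; exact hp.2 hp.1.symm
    have hs := sum_a_sg p.1 h1
    simp only [← mul_assoc, ← sum_mul]
    simp only [mul_assoc, ← mul_sum]
    rw [hs, ch_zero, sg_zero]
    ring
  change _ = coeff n K1 - _ + _ - 8 * coeff n (Lam (fun a x => (a : ℚ) * ch x) * Lam (fun b y => (b : ℚ) * sg b))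
  rw [← hm] at e2
  linear_combination e2

lemma I3 : E2 = 6 * (2 * S + 8 * S4 - 32 * S8) - 11 * K2 - 12 * K2 * (2 * S + 8 * S4 - 32 * S8) := by
  rw [← M_eq]
  ext n
  have hm := master (fun c _ => ch c) (fun c _ => ch_neg c) (fun _ _ => rfl) n
  have e1 : ∑ p ∈ Qn n, ((p.1 : ℚ) * p.2.1 * (ch ((p.1 : ℤ) + p.2.1)
      + ch ((p.1 : ℤ) - p.2.1) - 2 * ch p.1 - 2 * ch p.2.1))
      = - ∑ p ∈ Qn n, ((p.1 : ℚ) * ch p.1 * (p.2.1 * (2 - gg p.2.1))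
        + p.2.1 * ch p.2.1 * (p.1 * (2 - gg p.1))) := by
    rw [← sum_neg_distrib]
    refine sum_congr rfl fun p _ => ?_
    linear_combination (p.1 : ℚ) * p.2.1 * ch_add (p.1 : ℤ) p.2.1
  rw [e1, ← coeff_two_Lam_mul (fun a _ => (a : ℚ) * ch a) (fun b _ => (b : ℚ) * (2 - gg b))] at hm
  rw [show (6 : ℚ⟦X⟧) = C (6 : ℚ) from (map_ofNat C 6).symm,
    show (11 : ℚ⟦X⟧) = C (11 : ℚ) from (map_ofNat C 11).symm,
    show (12 : ℚ⟦X⟧) = C (12 : ℚ) from (map_ofNat C 12).symm, map_sub, map_sub,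
    mul_assoc (C (12 : ℚ)), coeff_C_mul, coeff_C_mul, coeff_C_mul]
  have e2 : coeff n E2 + 11 * coeff n K2 - 6 * coeff n (Lam (fun b _ => (b : ℚ) * (2 - gg b)))
      = 6 * ∑ p ∈ n.divisorsAntidiagonal,
      (((p.1 : ℚ) ^ 3 - p.1) / 6 * ch p.1
        - 2 * p.1 * ∑ a ∈ Finset.Ico 1 p.1, ((p.1 : ℚ) - a) * ch a
        + ((p.2 : ℚ) - 1) * p.1 ^ 2 * ch 0) := by
    unfold K2 E2
    simp only [coeff_Lam, mul_sum]
    rw [← sum_add_distrib, ← sum_sub_distrib]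
    refine sum_congr rfl fun p hp => ?_
    rw [Nat.mem_divisorsAntidiagonal] at hp
    have h1 : 1 ≤ p.1 := by
      apply Nat.pos_of_ne_zero; intro h; rw [h, zero_mul] at hp; exact hp.2 hp.1.symm
    have hs := sum_a_ch p.1 h1
    simp only [← mul_sum]
    rw [hs, ch_zero]
    ring
  rw [← hm] at e2
  change _ = _ - _ - 12 * coeff n (Lam (fun a _ => (a : ℚ) * ch a) * _)
  linear_combination e2

lemma I4 : 12 * ng K2 * (-8 * ex 4 Mm + 32 * ex 8 Mm) - 24 * K2 * Mm
    = E2 - K2 - 12 * Mm + 12 * ng K2 + 6 * (-8 * ex 4 Mm + 32 * ex 8 Mm) := by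
  rw [← Mgm_eq, ← ngK2]
  ext n
  have hm := master (fun c w => ch c * sg w) (fun c _ => by rw [ch_neg]) (fun _ w => by rw [sg_neg]) n
  have e1 : ∑ p ∈ Qn n, ((p.1 : ℚ) * p.2.1 * (ch ((p.1 : ℤ) + p.2.1) * sg ((p.2.2.1 : ℤ) - p.2.2.2)
      + ch ((p.1 : ℤ) - p.2.1) * sg ((p.2.2.1 : ℤ) + p.2.2.2) - 2 * (ch p.1 * sg p.2.2.2)
      - 2 * (ch p.2.1 * sg p.2.2.1)))
      = ∑ p ∈ Qn n, ((p.1 : ℚ) * ch p.1 * sg p.2.2.1 * (p.2.1 * gg p.2.1 * sg p.2.2.2)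
        + p.2.1 * ch p.2.1 * sg p.2.2.2 * (p.1 * gg p.1 * sg p.2.2.1))
       - 2 * ∑ p ∈ Qn n, ((p.1 : ℚ) * ch p.1 * (p.2.1 * sg p.2.2.2)
         + p.2.1 * ch p.2.1 * (p.1 * sg p.2.2.1)) := by
    rw [mul_sum, ← sum_sub_distrib]
    refine sum_congr rfl fun p _ => ?_
    rw [sg_add, sg_sub]
    linear_combination (p.1 : ℚ) * p.2.1 * sg p.2.2.1 * sg p.2.2.2 * ch_add (p.1 : ℤ) p.2.1
  rw [e1, ← coeff_two_Lam_mul (fun a x => (a : ℚ) * ch a * sg x) (fun b y => (b : ℚ) * gg b * sg y),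
    ← coeff_two_Lam_mul (fun a x => (a : ℚ) * ch a) (fun b y => (b : ℚ) * sg y)] at hm
  rw [show (6 : ℚ⟦X⟧) = C (6 : ℚ) from (map_ofNat C 6).symm,
    show (12 : ℚ⟦X⟧) = C (12 : ℚ) from (map_ofNat C 12).symm,
    show (24 : ℚ⟦X⟧) = C (24 : ℚ) from (map_ofNat C 24).symm, map_sub, map_add, map_add, map_sub, map_sub,
    mul_assoc (C (12 : ℚ)), mul_assoc (C (24 : ℚ)), coeff_C_mul, coeff_C_mul, coeff_C_mul, coeff_C_mul,
    coeff_C_mul]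
  have e2 : coeff n E2 - coeff n K2 - 12 * coeff n Mm + 12 * coeff n (Lam (fun a x => (a : ℚ) * ch a * sg x))
      + 6 * coeff n (Lam (fun b y => (b : ℚ) * gg b * sg y)) = 6 * ∑ p ∈ n.divisorsAntidiagonal,
      (((p.1 : ℚ) ^ 3 - p.1) / 6 * (ch p.1 * sg 0)
        - 2 * p.1 * ∑ a ∈ Finset.Ico 1 p.1, ((p.1 : ℚ) - a) * (ch a * sg p.2)
        + ((p.2 : ℚ) - 1) * p.1 ^ 2 * (ch 0 * sg p.2)) := by
    unfold K2 E2 Mm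
    simp only [coeff_Lam, mul_sum]
    rw [← sum_sub_distrib, ← sum_sub_distrib, ← sum_add_distrib, ← sum_add_distrib]
    refine sum_congr rfl fun p hp => ?_
    rw [Nat.mem_divisorsAntidiagonal] at hp
    have h1 : 1 ≤ p.1 := by
      apply Nat.pos_of_ne_zero; intro h; rw [h, zero_mul] at hp; exact hp.2 hp.1.symm
    have hs := sum_a_ch p.1 h1
    simp only [← mul_assoc, ← sum_mul]
    simp only [mul_assoc, ← mul_sum]
    rw [hs, ch_zero, sg_zero]
    ring
  rw [← hm] at e2
  change _ - 24 * coeff n (Lam (fun a x => (a : ℚ) * ch a) * Lam (fun b y => (b : ℚ) * sg y)) = _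
  linear_combination -e2

end RF8

set_option linter.unusedSimpArgs false

namespace RF8
open PowerSeries

lemma ex4_S2 : ex 4 S2 = S8 := ex_ex 4 2 8 rfl S
lemma ex8_S2 : ex 8 S2 = S16 := ex_ex 8 2 16 rfl S

lemma GLm : -2 * ex 4 Lm + 4 * ex 8 Lm = 2 * S4 - 12 * S8 + 16 * S16 := by
  rw [Lm_eq]; simp only [map_add, map_neg, map_mul, map_ofNat, ex4_S2, ex8_S2]; ring

lemma GMm : -8 * ex 4 Mm + 32 * ex 8 Mm = 8 * S4 - 48 * S8 + 64 * S16 := by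
  rw [Mm_eq]; simp only [map_add, map_neg, map_mul, map_ofNat, ex4_S2, ex8_S2]; ring

lemma J2 : 2 * DD K1 = K1 * (1 + 8 * S - 32 * S2) + ng K1 * (-1 + 8 * S4 - 48 * S8 + 64 * S16) := by
  rw [I2, GLm, Lm_eq]; ring

noncomputable def kk : ℚ⟦X⟧ := A * Cc * (A ^ 2 - B ^ 2)

lemma ng_C : ng Cc = Cc := ng_ex_even 2 (by decide) A

lemma ng_kk : ng kk = - (B * Cc * (A ^ 2 - B ^ 2)) := by
  unfold kk; simp only [map_mul, map_sub, map_pow, ng_A, ng_B, ng_C]; ring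

lemma DD_kk : DD kk = kk * (1 + 2 * S - 6 * S2 - 4 * S4 - 16 * S8) := by
  have := LD_mul (LD_mul LD_A LD_C) LD_w
  unfold LD at this
  unfold kk
  rw [this]; ring

lemma U1 : 2 * (1 - 4 * S + 20 * S2 - 8 * S4 - 32 * S8) = B ^ 2 * (A ^ 2 + B ^ 2) := by
  linear_combination Rel3 - Rel1

lemma V1 : 2 * (1 - 8 * S4 + 48 * S8 - 64 * S16) = A * B * (A ^ 2 + B ^ 2) := by
  linear_combination Rel3 - Rel4

lemma J2kk : 2 * DD kk = kk * (1 + 8 * S - 32 * S2) + ng kk * (-1 + 8 * S4 - 48 * S8 + 64 * S16) := by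
  apply mul_left_cancel₀ two_ne
  rw [DD_kk, ng_kk]
  unfold kk
  linear_combination A * Cc * (A ^ 2 - B ^ 2) * U1 - B * Cc * (A ^ 2 - B ^ 2) * V1

lemma coeff_mul_low {u f : ℚ⟦X⟧} {n : ℕ} (H : ∀ m < n, coeff m f = 0) :
    coeff n (f * u) = coeff n f * coeff 0 u := by
  rw [coeff_mul, Finset.sum_eq_single (n, 0)]
  · rintro ⟨a, b⟩ hp hne
    rw [HasAntidiagonal.mem_antidiagonal] at hp
    dsimp only at *
    have : a < n := by
      rcases Nat.lt_or_ge a n with h | h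
      · exact h
      · exfalso; apply hne; ext <;> simp <;> omega
    rw [H a this]; ring
  · intro hp; exfalso; apply hp; rw [HasAntidiagonal.mem_antidiagonal]; simp

lemma S0 : coeff 0 S = 0 := by unfold S; rw [coeff_Lam]; simp
lemma K10 : coeff 0 K1 = 0 := by unfold K1; rw [coeff_Lam]; simp
lemma K20 : coeff 0 K2 = 0 := by unfold K2; rw [coeff_Lam]; simp
lemma K11 : coeff 1 K1 = 1 := by unfold K1; rw [coeff_Lam]; simp [ch]

lemma kk0 : coeff 0 kk = 0 := by
  unfold kk
  simp only [map_sub, map_add, pow_succ, pow_zero, coeff_zero_mul', A0, B0, one0]; norm_num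
lemma kk1 : coeff 1 kk = 8 := by
  unfold kk
  simp only [map_sub, map_add, pow_succ, pow_zero, coeff_one_mul', coeff_zero_mul', A0, B0, A1, B1, C0, C1, one0, one1]
  norm_num

lemma K1_eq : 8 * K1 = kk := by
  rw [← sub_eq_zero]
  set d := 8 * K1 - kk with hd
  have H : 2 * DD d = d * (1 + 8 * S - 32 * S2) + ng d * (-1 + 8 * S4 - 48 * S8 + 64 * S16) := by
    have e1 : DD d = 8 * DD K1 - DD kk := by
      rw [hd, DD_sub, DD_mul, show (8 : ℚ⟦X⟧) = ((8 : ℕ) : ℚ⟦X⟧) by norm_num, DD_natCast]; ring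
    have e2 : ng d = 8 * ng K1 - ng kk := by rw [hd, map_sub, map_mul, map_ofNat]
    rw [e1, e2, hd]
    linear_combination 8 * J2 - J2kk
  ext n
  rw [map_zero]
  induction n using Nat.strong_induction_on with
  | _ n ih =>
    have h3 := congrArg (coeff n) H
    rw [map_add, coeff_mul_low ih, coeff_mul_low (f := ng d) (fun m hm => by rw [coeff_ng, ih m hm]; ring),
      show (2 : ℚ⟦X⟧) = C (2 : ℚ) from (map_ofNat C 2).symm, coeff_C_mul, coeff_DD, coeff_ng] at h3
    have c1 : coeff 0 (1 + 8 * S - 32 * S2) = 1 := by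
      simp only [map_sub, map_add, coeff_zero_mul', one0, cf0 8, cf0 32, ex0, S0]; norm_num
    have c2 : coeff 0 (-1 + 8 * S4 - 48 * S8 + 64 * S16) = -1 := by
      simp only [map_sub, map_add, map_neg, coeff_zero_mul', one0, cf0 8, cf0 48, cf0 64, ex0, S0]; norm_num
    rw [c1, c2] at h3
    rcases Nat.lt_or_ge n 2 with hn | hn
    · interval_cases n
      · rw [hd, map_sub, coeff_zero_mul', K10, kk0]; norm_num
      · rw [hd, map_sub, coeff_one_mul', K11, kk1, cf0 8, cf1 8, K10]; norm_num
    · have hn' : (2 : ℚ) ≤ n := by exact_mod_cast hn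
      have : (2 * (n : ℚ) - 1 + (-1) ^ n) * coeff n d = 0 := by linear_combination h3
      rcases mul_eq_zero.1 this with h | h
      · exfalso
        rcases neg_one_pow_eq_or ℚ n with e | e <;> rw [e] at h <;> linarith
      · exact h

lemma zero_of_order' {f u v : ℚ⟦X⟧} (h0 : coeff 0 f = 0)
    (hu : coeff 0 u ≠ 0) (hv : coeff 0 v ≠ 0) (H : f * u = v * ex 2 f) : f = 0 := by
  by_contra hf
  have e := congrArg order H
  rw [order_mul, order_mul, order_ex] at e
  have hv' : v.order = 0 := by
    apply order_eq_nat (n := 0) |>.2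
    exact ⟨hv, by simp⟩
  have hu' : u.order = 0 := by
    apply order_eq_nat (n := 0) |>.2
    exact ⟨hu, by simp⟩
  have hf2 : (1 : ℕ∞) ≤ f.order := by
    apply nat_le_order (n := 1)
    intro i hi
    interval_cases i
    exact h0
  rw [hv', hu', zero_add, add_zero] at e
  have hft : f.order ≠ ⊤ := by rwa [Ne, order_eq_top]
  lift f.order to ℕ using hft with d
  norm_cast at *
  omega

lemma Y2_mul : (1 - 2 * K2) * A = (1 - 2 * ng K2) * B := by
  have hU := Rel3
  have hV := V1
  have h4 := I4
  rw [I3, GMm, Mm_eq] at h4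
  have six : (12 * (A * (A ^ 2 + B ^ 2))) ≠ 0 := by
    apply ne_zero_of_coeff 0
    simp only [map_sub, map_add, pow_succ, pow_zero, coeff_zero_mul', A0, B0, one0, cf0 12]; norm_num
  apply mul_left_cancel₀ six
  linear_combination (-12 * (1 - 2 * K2)) * hU + 12 * (1 - 2 * ng K2) * hV - 4 * h4

lemma K2_add : K2 + ng K2 = 2 * ex 2 K2 := by
  rw [← ngK2]
  unfold K2
  rw [← Lam_add, ← Lam_ex_x 2 (fun a _ => (a : ℚ) * ch a),
    show (2 : ℚ⟦X⟧) = C (2 : ℚ) from (map_ofNat C 2).symm, ← Lam_smul]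
  apply Lam_ext
  intro a x; rw [sg_eq]; split_ifs <;> ring

lemma K2_eq : 1 - 2 * K2 = A * B ^ 2 * Cc := by
  rw [← sub_eq_zero]
  apply zero_of_order' (u := A + B) (v := 2 * B)
  · simp only [map_sub, map_add, pow_succ, pow_zero, coeff_zero_mul', A0, B0, C0, K20, one0, cf0 2]; norm_num
  · simp only [map_add, A0, B0]; norm_num
  · simp only [coeff_zero_mul', B0, cf0 2]; norm_num
  · have e : ex 2 (1 - 2 * K2 - A * B ^ 2 * Cc) = 1 - 2 * ex 2 K2 - Cc * Dc ^ 2 * Ec := by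
      simp only [map_sub, map_mul, map_one, map_ofNat, map_pow]
      rw [ex2_C]; rfl
    rw [e]
    linear_combination Y2_mul - 2 * B * K2_add - A * B ^ 2 * Cc * A_add_B
      - 2 * Ec * B * Cc * A_mul_B

lemma E1_eq : 128 * E1 = kk * (11 * A ^ 4 + 6 * A ^ 2 * B ^ 2 - B ^ 4) := by
  have h1 := I1
  have hD : 8 * DD K1 = DD kk := by
    rw [← K1_eq, DD_mul, show (8 : ℚ⟦X⟧) = ((8 : ℕ) : ℚ⟦X⟧) by norm_num, DD_natCast]; ring
  rw [h1]
  have h2 := DD_kk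
  rw [← hD] at h2
  have h3 := Q1rel
  rw [← h3, ← K1_eq]
  rw [← K1_eq] at h2
  linear_combination 16 * h2

lemma E2_eq : 2 * E2 + 11 = A * B ^ 2 * Cc * (4 * A ^ 4 + 6 * A ^ 2 * B ^ 2 + B ^ 4) := by
  rw [← K2_eq]
  apply mul_left_cancel₀ two_ne
  linear_combination 4 * I3 + (1 - 2 * K2) * Q2rel

end RF8

namespace RF8
open PowerSeries

lemma poly_id {R : Type*} [CommRing R] (E F c d : R) (hc : c = E ^ 2 + F ^ 2) (hd : d = E ^ 2 - F ^ 2) :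
    88 * (E + F) ^ 4 * E ^ 3 =
      (E + F) * ((E + F) ^ 2 - (E - F) ^ 2) *
        (11 * (E + F) ^ 4 + 6 * (E + F) ^ 2 * (E - F) ^ 2 - (E - F) ^ 4)
      + 8 * d * E * (4 * c ^ 2 + 6 * c * d + d ^ 2)
      + 4 * (E + F) ^ 3 * (E - F) ^ 2 * ((E + F) ^ 2 - (E - F) ^ 2)
      + 68 * (E + F) * (E - F) ^ 2 * c * ((E + F) ^ 2 - (E - F) ^ 2)
      + 180 * c * d * E * (c - d) + 104 * d * E ^ 3 * (c - d) := by
  subst hc hd; ring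

lemma main_id (α₁ α₂ : ℚ⟦X⟧) (h1 : 8 * α₁ = A ^ 3 * B ^ 2 * Cc * (A ^ 2 - B ^ 2))
    (h2 : 8 * α₂ = A * B ^ 2 * Cc ^ 3 * (A ^ 2 - B ^ 2)) :
    11 * (A ^ 4 * Cc * Ec ^ 3) = 16 * E1 + 2 * ex 2 E2 + 11 + 4 * α₁ + 68 * α₂ + 180 * ex 2 α₁ + 104 * ex 2 α₂ := by
  have e1 : 8 * ex 2 α₁ = Cc ^ 3 * Dc ^ 2 * Ec * (Cc ^ 2 - Dc ^ 2) := by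
    have := congrArg (ex 2) h1
    simp only [map_mul, map_pow, map_sub, map_ofNat, ex2_C] at this
    exact this
  have e2 : 8 * ex 2 α₂ = Cc * Dc ^ 2 * Ec ^ 3 * (Cc ^ 2 - Dc ^ 2) := by
    have := congrArg (ex 2) h2
    simp only [map_mul, map_pow, map_sub, map_ofNat, ex2_C] at this
    exact this
  have e3 : 2 * ex 2 E2 + 11 = Cc * Dc ^ 2 * Ec * (4 * Cc ^ 4 + 6 * Cc ^ 2 * Dc ^ 2 + Dc ^ 4) := by
    have := congrArg (ex 2) E2_eq
    simp only [map_mul, map_pow, map_add, map_ofNat, ex2_C] at this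
    exact this
  have e4 := E1_eq
  unfold kk at e4
  have hA : Ec + (Ec - B) = A := by linear_combination -A_add_B
  have hB : Ec - (Ec - B) = B := by ring
  have hc : Cc ^ 2 = Ec ^ 2 + (Ec - B) ^ 2 := by
    apply mul_left_cancel₀ two_ne
    have : A = 2 * Ec - B := by linear_combination A_add_B
    have h3 := A_sq_add
    rw [this] at h3
    linear_combination -h3
  have hd : Dc ^ 2 = Ec ^ 2 - (Ec - B) ^ 2 := by
    have : A = 2 * Ec - B := by linear_combination A_add_B
    have h3 := A_mul_B
    rw [this] at h3
    linear_combination -h3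
  have P := poly_id Ec (Ec - B) (Cc ^ 2) (Dc ^ 2) hc hd
  rw [hA, hB] at P
  have e8 : (8 : ℚ⟦X⟧) ≠ 0 := ne_zero_of_coeff 0 (by rw [cf0 8]; norm_num)
  apply mul_left_cancel₀ e8
  linear_combination Cc * P - e4 - 8 * e3 - 4 * h1 - 68 * h2 - 180 * e1 - 104 * e2

lemma alpha1 (α : ℚ⟦X⟧) (H : α * (h ^ 2 * h4 ^ 3) = X * h2 ^ 11 * h8 ^ 2) :
    8 * α = A ^ 3 * B ^ 2 * Cc * (A ^ 2 - B ^ 2) := by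
  have hne : h ^ 6 * h4 ^ 8 * h2 ^ 4 * h8 ^ 2 ≠ 0 :=
    mul_ne_zero (mul_ne_zero (mul_ne_zero (pow_ne_zero _ h_ne) (pow_ne_zero _ h4_ne)) (pow_ne_zero _ h2_ne)) (pow_ne_zero _ h8_ne)
  apply mul_right_cancel₀ hne
  have e1 : A ^ 3 * (h ^ 6 * h4 ^ 6) = h2 ^ 15 := by
    have := congrArg (· ^ 3) A_h; linear_combination this
  have e2 : B ^ 2 * h2 ^ 2 = h ^ 4 := by
    have := congrArg (· ^ 2) gauss; linear_combination this
  have e3 := C_h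
  have e4 := w_h
  calc 8 * α * (h ^ 6 * h4 ^ 8 * h2 ^ 4 * h8 ^ 2)
      = 8 * (α * (h ^ 2 * h4 ^ 3)) * (h ^ 4 * h4 ^ 5 * h2 ^ 4 * h8 ^ 2) := by ring
    _ = h2 ^ 15 * h ^ 4 * h4 ^ 5 * (8 * X * h8 ^ 4) := by rw [H]; ring
    _ = _ := by rw [← e1, ← e2, ← e3, ← e4]; ring

lemma alpha2 (α : ℚ⟦X⟧) (H : α * (h2 ^ 3 * h8 ^ 2) = X * h ^ 2 * h4 ^ 11) :
    8 * α = A * B ^ 2 * Cc ^ 3 * (A ^ 2 - B ^ 2) := by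
  have hne : h ^ 2 * h4 ^ 4 * h2 ^ 8 * h8 ^ 6 ≠ 0 :=
    mul_ne_zero (mul_ne_zero (mul_ne_zero (pow_ne_zero _ h_ne) (pow_ne_zero _ h4_ne)) (pow_ne_zero _ h2_ne)) (pow_ne_zero _ h8_ne)
  apply mul_right_cancel₀ hne
  have e1 := A_h
  have e2 : B ^ 2 * h2 ^ 2 = h ^ 4 := by
    have := congrArg (· ^ 2) gauss; linear_combination this
  have e3 : Cc ^ 3 * (h2 ^ 6 * h8 ^ 6) = h4 ^ 15 := by
    have := congrArg (· ^ 3) C_h; linear_combination this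
  have e4 := w_h
  calc 8 * α * (h ^ 2 * h4 ^ 4 * h2 ^ 8 * h8 ^ 6)
      = 8 * (α * (h2 ^ 3 * h8 ^ 2)) * (h ^ 2 * h4 ^ 4 * h2 ^ 5 * h8 ^ 4) := by ring
    _ = h2 ^ 5 * h ^ 4 * h4 ^ 15 * (8 * X * h8 ^ 4) := by rw [H]; ring
    _ = _ := by rw [← e1, ← e2, ← e3, ← e4]; ring

end RF8

namespace RF8
open PowerSeries Filter Topology

/-- `EV f z v`: the series `f` converges absolutely at `z` with value `v`. -/
def EV (f : ℚ⟦X⟧) (z v : ℂ) : Prop :=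
  (Summable fun n : ℕ => ‖((coeff n f : ℚ) : ℂ) * z ^ n‖) ∧ ∑' n : ℕ, ((coeff n f : ℚ) : ℂ) * z ^ n = v

lemma EV_mul {f g : ℚ⟦X⟧} {z v w : ℂ} (hf : EV f z v) (hg : EV g z w) : EV (f * g) z (v * w) := by
  have e : ∀ n : ℕ, ((coeff n (f * g) : ℚ) : ℂ) * z ^ n
      = ∑ kl ∈ antidiagonal n, (((coeff kl.1 f : ℚ) : ℂ) * z ^ kl.1) * (((coeff kl.2 g : ℚ) : ℂ) * z ^ kl.2) := by
    intro n
    rw [coeff_mul]; push_cast; rw [sum_mul]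
    refine sum_congr rfl fun p hp => ?_
    rw [HasAntidiagonal.mem_antidiagonal] at hp
    rw [← hp, pow_add]; ring
  have h1 := summable_norm_sum_mul_antidiagonal_of_summable_norm hf.1 hg.1
  have h2 := tsum_mul_tsum_eq_tsum_sum_antidiagonal_of_summable_norm hf.1 hg.1
  rw [hf.2, hg.2] at h2
  refine ⟨h1.congr fun n => ?_, ?_⟩
  · rw [e]
  · rw [h2]; exact tsum_congr e

lemma EV_one (z : ℂ) : EV 1 z 1 := by
  have e : ∀ n : ℕ, ((coeff n (1 : ℚ⟦X⟧) : ℚ) : ℂ) * z ^ n = if n = 0 then 1 else 0 := by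
    intro n; rw [coeff_one]; split_ifs with h <;> simp [h]
  unfold EV
  simp only [e]
  refine ⟨?_, by simp⟩
  apply summable_of_ne_finset_zero (s := {0})
  intro b hb; rw [Finset.mem_singleton] at hb; simp [hb]

lemma EV_X (z : ℂ) : EV X z z := by
  have e : ∀ n : ℕ, ((coeff n (X : ℚ⟦X⟧) : ℚ) : ℂ) * z ^ n = if n = 1 then z else 0 := by
    intro n; rw [coeff_X]; split_ifs with h <;> simp [h]
  unfold EV
  simp only [e]
  refine ⟨?_, by simp⟩
  apply summable_of_ne_finset_zero (s := {1})
  intro b hb; rw [Finset.mem_singleton] at hb; simp [hb]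

lemma EV_pow {f : ℚ⟦X⟧} {z v : ℂ} (hf : EV f z v) (n : ℕ) : EV (f ^ n) z (v ^ n) := by
  induction n with
  | zero => simpa using EV_one z
  | succ n ih => rw [pow_succ, pow_succ]; exact EV_mul ih hf

lemma EV_ex (k : ℕ) [NeZero k] {f : ℚ⟦X⟧} {z v : ℂ} (hf : EV f (z ^ k) v) : EV (ex k f) z v := by
  have hk : 0 < k := Nat.pos_of_ne_zero (NeZero.ne k)
  have inj : Function.Injective (fun n : ℕ => k * n) := fun a b h => Nat.eq_of_mul_eq_mul_left hk h
  have e : ∀ n : ℕ, ((coeff (k * n) (ex k f) : ℚ) : ℂ) * z ^ (k * n) = ((coeff n f : ℚ) : ℂ) * (z ^ k) ^ n := by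
    intro n; rw [coeff_ex, if_pos (Dvd.intro _ rfl), Nat.mul_div_cancel_left _ hk, pow_mul]
  have z0 : ∀ n : ℕ, n ∉ Set.range (fun n : ℕ => k * n) → coeff n (ex k f) = 0 := by
    intro n hn
    rw [coeff_ex, if_neg]
    rintro ⟨m, rfl⟩; exact hn ⟨m, rfl⟩
  constructor
  · rw [← inj.summable_iff (fun n hn => by rw [z0 n hn]; simp)]
    have := hf.1
    simp only [← e] at this
    exact this
  · rw [← hf.2]
    simp only [← e]
    symm
    apply inj.tsum_eq (f := fun n => ((coeff n (ex k f) : ℚ) : ℂ) * z ^ n)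
    intro n hn
    by_contra hc
    apply hn
    simp only [z0 n hc]; simp

lemma EV_unique {f : ℚ⟦X⟧} (H : ∀ z : ℂ, ‖z‖ < 1 → EV f z 0) : f = 0 := by
  let p : FormalMultilinearSeries ℂ ℂ ℂ :=
    FormalMultilinearSeries.ofScalars ℂ (fun n => ((coeff n f : ℚ) : ℂ))
  have hp : HasFPowerSeriesAt (0 : ℂ → ℂ) p 0 := by
    rw [hasFPowerSeriesAt_iff]
    filter_upwards [Metric.ball_mem_nhds (0 : ℂ) one_pos] with z hz
    have hz' : ‖z‖ < 1 := by simpa using hz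
    obtain ⟨h1, h2⟩ := H z hz'
    have h3 := h1.of_norm.hasSum
    rw [h2] at h3
    convert h3 using 2 with n
    · simp only [p, FormalMultilinearSeries.coeff_ofScalars, smul_eq_mul]
      ring
    · rfl
  have := hp.eq_zero
  ext n
  have h3 : p.coeff n = 0 := by rw [this]; rfl
  simp only [p, FormalMultilinearSeries.coeff_ofScalars] at h3
  rw [map_zero]
  exact_mod_cast h3

lemma EV_inj {f g : ℚ⟦X⟧} (v : ℂ → ℂ) (Hf : ∀ z : ℂ, ‖z‖ < 1 → EV f z (v z))
    (Hg : ∀ z : ℂ, ‖z‖ < 1 → EV g z (v z)) : f = g := by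
  rw [← sub_eq_zero]
  apply EV_unique
  intro z hz
  obtain ⟨a1, a2⟩ := Hf z hz
  obtain ⟨b1, b2⟩ := Hg z hz
  have e : ∀ n : ℕ, ((coeff n (f - g) : ℚ) : ℂ) * z ^ n
      = ((coeff n f : ℚ) : ℂ) * z ^ n - ((coeff n g : ℚ) : ℂ) * z ^ n := by
    intro n; rw [map_sub]; push_cast; ring
  unfold EV
  simp only [e]
  refine ⟨(a1.of_norm.sub b1.of_norm).norm, ?_⟩
  rw [a1.of_norm.tsum_sub b1.of_norm, a2, b2, sub_self]

lemma Hp_bound {r : ℝ} (hr : 0 ≤ r) (n m : ℕ) :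
    |((coeff m (Hp n) : ℚ) : ℝ)| * r ^ m ≤ ∏ k ∈ range n, (1 + r ^ (k + 1)) := by
  induction n generalizing m with
  | zero =>
    simp only [Hp, prod_range_zero, coeff_one]
    split_ifs with h <;> simp [h]
  | succ n ih =>
    have e : Hp (n + 1) = Hp n - Hp n * X ^ (n + 1) := by unfold Hp; rw [prod_range_succ]; ring
    rw [e, map_sub, coeff_mul_X_pow', prod_range_succ]
    have h1 := ih m
    split_ifs with hm
    · have h2 := ih (m - (n + 1))
      have h3 : r ^ m = r ^ (m - (n + 1)) * r ^ (n + 1) := by rw [← pow_add]; congr 1; omega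
      have h4 : |(((coeff m (Hp n) - coeff (m - (n + 1)) (Hp n) : ℚ)) : ℝ)|
          ≤ |((coeff m (Hp n) : ℚ) : ℝ)| + |((coeff (m - (n + 1)) (Hp n) : ℚ) : ℝ)| := by
        push_cast; exact abs_sub _ _
      calc _ ≤ (|((coeff m (Hp n) : ℚ) : ℝ)| + |((coeff (m - (n + 1)) (Hp n) : ℚ) : ℝ)|) * r ^ m :=
            mul_le_mul_of_nonneg_right h4 (by positivity)
        _ = |((coeff m (Hp n) : ℚ) : ℝ)| * r ^ m
            + (|((coeff (m - (n + 1)) (Hp n) : ℚ) : ℝ)| * r ^ (m - (n + 1))) * r ^ (n + 1) := by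
            rw [add_mul]; congr 1; rw [h3]; ring
        _ ≤ _ := by rw [mul_add, mul_one]; exact add_le_add h1 (mul_le_mul_of_nonneg_right h2 (by positivity))
    · rw [sub_zero]
      refine h1.trans ?_
      apply le_mul_of_one_le_right
      · apply prod_nonneg; intros; positivity
      · have : 0 ≤ r ^ (n + 1) := by positivity
        linarith

lemma prod_le {r : ℝ} (hr : 0 ≤ r) (hr1 : r < 1) (n : ℕ) :
    ∏ k ∈ range n, (1 + r ^ (k + 1)) ≤ Real.exp (∑' k : ℕ, r ^ k) := by
  calc ∏ k ∈ range n, (1 + r ^ (k + 1)) ≤ ∏ k ∈ range n, Real.exp (r ^ (k + 1)) := by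
        apply Finset.prod_le_prod
        · intros; positivity
        · intro k _; rw [add_comm]; exact Real.add_one_le_exp _
    _ = Real.exp (∑ k ∈ range n, r ^ (k + 1)) := by rw [Real.exp_sum]
    _ ≤ _ := by
      apply Real.exp_le_exp.2
      have hs := summable_geometric_of_lt_one hr hr1
      calc ∑ k ∈ range n, r ^ (k + 1) ≤ ∑ k ∈ range n, r ^ k := by
            apply sum_le_sum; intro k _; exact pow_le_pow_of_le_one hr hr1.le (by omega)
        _ ≤ _ := hs.sum_le_tsum _ (fun _ _ => by positivity)

lemma coeff_h_eq (m n : ℕ) (hm : m ≤ n) : coeff m (Hp n) = coeff m h := by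
  have := X_pow_dvd_iff.1 (h_dvd n) m (by omega)
  rw [map_sub] at this; linarith

/-- The Euler product. -/
noncomputable def Pr (z : ℂ) : ℂ := ∏' m : ℕ, (1 - z ^ (m + 1))

lemma EV_sub_one_mul (f : ℚ⟦X⟧) (z v : ℂ) (hf : EV f z v) (n : ℕ) : EV (f - f * X ^ n) z (v - v * z ^ n) := by
  have hg := EV_mul hf (EV_pow (EV_X z) n)
  obtain ⟨a1, a2⟩ := hf
  obtain ⟨b1, b2⟩ := hg
  have e : ∀ m : ℕ, ((coeff m (f - f * X ^ n) : ℚ) : ℂ) * z ^ m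
      = ((coeff m f : ℚ) : ℂ) * z ^ m - ((coeff m (f * X ^ n) : ℚ) : ℂ) * z ^ m := by
    intro n; rw [map_sub]; push_cast; ring
  unfold EV
  simp only [e]
  refine ⟨(a1.of_norm.sub b1.of_norm).norm, ?_⟩
  rw [a1.of_norm.tsum_sub b1.of_norm, a2, b2]

lemma EV_Hp (z : ℂ) (n : ℕ) : EV (Hp n) z (∏ k ∈ range n, (1 - z ^ (k + 1))) := by
  induction n with
  | zero => simpa [Hp] using EV_one z
  | succ n ih =>
    have e : Hp (n + 1) = Hp n - Hp n * X ^ (n + 1) := by unfold Hp; rw [prod_range_succ]; ring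
    rw [e, prod_range_succ, mul_sub, mul_one]
    exact EV_sub_one_mul _ _ _ ih _

lemma EV_h {z : ℂ} (hz : ‖z‖ < 1) : EV h z (Pr z) := by
  obtain ⟨r, hr1, hr2⟩ := exists_between hz
  have hr0 : 0 < r := lt_of_le_of_lt (norm_nonneg _) hr1
  set M := Real.exp (∑' k : ℕ, r ^ k)
  have key : ∀ n m : ℕ, ‖((coeff m (Hp n) : ℚ) : ℂ) * z ^ m‖ ≤ M * (‖z‖ / r) ^ m := by
    intro n m
    have h1 := (Hp_bound hr0.le n m).trans (prod_le hr0.le hr2 n)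
    have h2 : ‖((coeff m (Hp n) : ℚ) : ℂ)‖ = |((coeff m (Hp n) : ℚ) : ℝ)| := by
      rw [← Complex.ofReal_ratCast, Complex.norm_real, Real.norm_eq_abs]
    rw [norm_mul, norm_pow, h2, div_pow]
    calc |((coeff m (Hp n) : ℚ) : ℝ)| * ‖z‖ ^ m
        = (|((coeff m (Hp n) : ℚ) : ℝ)| * r ^ m) * (‖z‖ ^ m / r ^ m) := by
          field_simp
      _ ≤ _ := mul_le_mul_of_nonneg_right h1 (by positivity)
  have hs : Summable fun m : ℕ => M * (‖z‖ / r) ^ m :=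
    (summable_geometric_of_lt_one (by positivity) ((div_lt_one hr0).2 hr1)).mul_left _
  refine ⟨?_, ?_⟩
  · apply Summable.of_nonneg_of_le (fun _ => norm_nonneg _) _ hs
    intro m
    rw [← coeff_h_eq m m le_rfl]; exact key m m
  · have t1 : Tendsto (fun n : ℕ => ∑' m : ℕ, ((coeff m (Hp n) : ℚ) : ℂ) * z ^ m) atTop
        (𝓝 (∑' m : ℕ, ((coeff m h : ℚ) : ℂ) * z ^ m)) := by
      apply tendsto_tsum_of_dominated_convergence hs
      · intro m
        apply tendsto_const_nhds.congr'
        filter_upwards [eventually_ge_atTop m] with n hn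
        rw [coeff_h_eq m n hn]
      · exact Eventually.of_forall key
    have t2 := (ModularForm.multipliable_one_sub_pow hz).hasProd.tendsto_prod_nat
    refine tendsto_nhds_unique t1 (t2.congr fun n => ?_)
    exact (EV_Hp z n).2.symm

lemma Pr_ne {z : ℂ} (hz : ‖z‖ < 1) : Pr z ≠ 0 := by
  refine tprod_one_add_ne_zero_of_summable (f := fun n : ℕ ↦ -z ^ (n + 1)) ?_ ?_
  · intro i hc
    have : z ^ (i + 1) = 1 := by linear_combination -hc
    have h1 := congrArg norm this
    rw [norm_pow, norm_one] at h1
    have := pow_lt_one₀ (norm_nonneg z) hz (Nat.succ_ne_zero i)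
    exact absurd h1 this.ne
  · simpa using (summable_nat_add_iff 1).mpr (summable_geometric_of_lt_one (norm_nonneg _) hz)

lemma eta_eq (z : ℂ) (k : ℕ) : dedekindEta (k * z) =
    Complex.exp (Real.pi * Complex.I * z / 12) ^ k * Pr (Complex.exp (2 * Real.pi * Complex.I * z) ^ k) := by
  unfold dedekindEta Pr
  congr 1
  · rw [← Complex.exp_nat_mul]; congr 1; ring
  · congr 1; funext m
    rw [← pow_mul, ← Complex.exp_nat_mul]; congr 2; push_cast; ring

lemma exists_z {q : ℂ} (h0 : q ≠ 0) (h1 : ‖q‖ < 1) :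
    ∃ z : ℂ, 0 < z.im ∧ Complex.exp (2 * Real.pi * Complex.I * z) = q := by
  refine ⟨Complex.log q / (2 * Real.pi * Complex.I), ?_, ?_⟩
  · have : Complex.log q / (2 * Real.pi * Complex.I) = -(Complex.log q / (2 * Real.pi : ℝ)) * Complex.I := by
      have := Complex.I_sq
      have hpi : (Real.pi : ℂ) ≠ 0 := by exact_mod_cast Real.pi_ne_zero
      push_cast
      field_simp
      rw [this]; ring
    rw [this, Complex.mul_I_im, Complex.neg_re, Complex.div_ofReal_re, Complex.log_re]
    have : Real.log ‖q‖ < 0 := Real.log_neg (norm_pos_iff.2 h0) h1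
    have h2 : 0 < 2 * Real.pi := by positivity
    rw [neg_pos]; exact div_neg_of_neg_of_pos this h2
  · rw [mul_div_cancel₀, Complex.exp_log h0]
    exact Complex.two_pi_I_ne_zero

end RF8

namespace RF8
open PowerSeries Filter Topology

/-- Formal series attached to the coefficients `a n`, `n ≥ 1`. -/
noncomputable def al (a : ℕ → ℤ) : ℚ⟦X⟧ := mk fun n => if n = 0 then 0 else (a n : ℚ)

lemma EV_al_zero (a : ℕ → ℤ) : EV (al a) 0 0 := by
  have e : ∀ n : ℕ, ((coeff n (al a) : ℚ) : ℂ) * 0 ^ n = 0 := by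
    intro n; unfold al; rw [coeff_mk]; split_ifs with h <;> simp [h]
  unfold EV; simp only [e]; simp [summable_zero]

lemma EV_al (a : ℕ → ℤ) (q F : ℂ) (hF : F ≠ 0) (H : F = ∑' m : ℕ, (a (m + 1) : ℂ) * q ^ (m + 1)) :
    EV (al a) q F := by
  have e : ∀ m : ℕ, ((coeff (m + 1) (al a) : ℚ) : ℂ) * q ^ (m + 1) = (a (m + 1) : ℂ) * q ^ (m + 1) := by
    intro m; unfold al; rw [coeff_mk, if_neg (Nat.succ_ne_zero m)]; push_cast; rfl
  have hs : Summable fun m : ℕ => (a (m + 1) : ℂ) * q ^ (m + 1) := by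
    by_contra hc
    rw [tsum_eq_zero_of_not_summable hc] at H
    exact hF H
  have hs2 : Summable fun n : ℕ => ((coeff n (al a) : ℚ) : ℂ) * q ^ n := by
    rw [← summable_nat_add_iff 1]
    simp only [e]; exact hs
  refine ⟨hs2.norm, ?_⟩
  rw [hs2.tsum_eq_zero_add, H]
  simp only [e]
  simp [al]

lemma norm_q {z : ℂ} (hz : 0 < z.im) : ‖Complex.exp (2 * Real.pi * Complex.I * z)‖ < 1 := by
  have := UpperHalfPlane.norm_exp_two_pi_I_lt_one ⟨z, hz⟩
  simpa using this

lemma npow_lt {q : ℂ} (hq : ‖q‖ < 1) (k : ℕ) (hk : k ≠ 0) : ‖q ^ k‖ < 1 := by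
  rw [norm_pow]; exact pow_lt_one₀ (norm_nonneg _) hq hk

lemma eta1 (z : ℂ) : dedekindEta z =
    Complex.exp (Real.pi * Complex.I * z / 12) * Pr (Complex.exp (2 * Real.pi * Complex.I * z)) := by
  have := eta_eq z 1; simpa using this

lemma eta2 (z : ℂ) : dedekindEta (2 * z) =
    Complex.exp (Real.pi * Complex.I * z / 12) ^ 2 * Pr (Complex.exp (2 * Real.pi * Complex.I * z) ^ 2) := by
  have := eta_eq z 2; rwa [Nat.cast_ofNat] at this

lemma eta4 (z : ℂ) : dedekindEta (4 * z) =
    Complex.exp (Real.pi * Complex.I * z / 12) ^ 4 * Pr (Complex.exp (2 * Real.pi * Complex.I * z) ^ 4) := by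
  have := eta_eq z 4; rwa [Nat.cast_ofNat] at this

lemma eta8 (z : ℂ) : dedekindEta (8 * z) =
    Complex.exp (Real.pi * Complex.I * z / 12) ^ 8 * Pr (Complex.exp (2 * Real.pi * Complex.I * z) ^ 8) := by
  have := eta_eq z 8; rwa [Nat.cast_ofNat] at this

lemma t_pow (z : ℂ) : Complex.exp (Real.pi * Complex.I * z / 12) ^ 24
    = Complex.exp (2 * Real.pi * Complex.I * z) := by
  rw [← Complex.exp_nat_mul]; congr 1; push_cast; ring

lemma formal1 (a : ℕ → ℤ) (ha : ∀ z : ℂ, 0 < z.im →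
      dedekindEta z ^ (-2 : ℤ) * dedekindEta (2 * z) ^ (11 : ℤ) * dedekindEta (4 * z) ^ (-3 : ℤ) * dedekindEta (8 * z) ^ (2 : ℤ)
        = ∑' m : ℕ, (a (m + 1) : ℂ) * Complex.exp (2 * Real.pi * Complex.I * z) ^ (m + 1)) :
    al a * (h ^ 2 * h4 ^ 3) = X * h2 ^ 11 * h8 ^ 2 := by
  apply EV_inj (fun q => q * Pr (q ^ 2) ^ 11 * Pr (q ^ 8) ^ 2)
  · intro q hq
    have p1 := Pr_ne hq
    have p2 := Pr_ne (npow_lt hq 2 (by norm_num))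
    have p4 := Pr_ne (npow_lt hq 4 (by norm_num))
    have p8 := Pr_ne (npow_lt hq 8 (by norm_num))
    have base : EV (h ^ 2 * h4 ^ 3) q (Pr q ^ 2 * Pr (q ^ 4) ^ 3) :=
      EV_mul (EV_pow (EV_h hq) 2) (EV_pow (EV_ex 4 (EV_h (npow_lt hq 4 (by norm_num)))) 3)
    by_cases q0 : q = 0
    · subst q0
      have := EV_mul (EV_al_zero a) base
      simpa using this
    · obtain ⟨z, hz, hzq⟩ := exists_z q0 hq
      have hv := ha z hz
      have ht := t_pow z
      rw [eta1, eta2, eta4, eta8, hzq] at hv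
      rw [hzq] at ht
      have t0 : Complex.exp (Real.pi * Complex.I * z / 12) ≠ 0 := Complex.exp_ne_zero _
      generalize Complex.exp (Real.pi * Complex.I * z / 12) = t at *
      have hF : (t * Pr q) ^ (-2 : ℤ) * (t ^ 2 * Pr (q ^ 2)) ^ (11 : ℤ) * (t ^ 4 * Pr (q ^ 4)) ^ (-3 : ℤ)
          * (t ^ 8 * Pr (q ^ 8)) ^ (2 : ℤ)
          = q * Pr (q ^ 2) ^ 11 * Pr (q ^ 8) ^ 2 / (Pr q ^ 2 * Pr (q ^ 4) ^ 3) := by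
        rw [← ht] at *
        simp only [zpow_neg, zpow_ofNat]
        field_simp
      rw [hF] at hv
      have := EV_mul (EV_al a q _ (div_ne_zero (by positivity) (by positivity)) hv) base
      rwa [div_mul_cancel₀ _ (by positivity)] at this
  · intro q hq
    exact EV_mul (EV_mul (EV_X q) (EV_pow (EV_ex 2 (EV_h (npow_lt hq 2 (by norm_num)))) 11))
      (EV_pow (EV_ex 8 (EV_h (npow_lt hq 8 (by norm_num)))) 2)

lemma formal2 (a : ℕ → ℤ) (ha : ∀ z : ℂ, 0 < z.im →
      dedekindEta z ^ (2 : ℤ) * dedekindEta (2 * z) ^ (-3 : ℤ) * dedekindEta (4 * z) ^ (11 : ℤ) * dedekindEta (8 * z) ^ (-2 : ℤ)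
        = ∑' m : ℕ, (a (m + 1) : ℂ) * Complex.exp (2 * Real.pi * Complex.I * z) ^ (m + 1)) :
    al a * (h2 ^ 3 * h8 ^ 2) = X * h ^ 2 * h4 ^ 11 := by
  apply EV_inj (fun q => q * Pr q ^ 2 * Pr (q ^ 4) ^ 11)
  · intro q hq
    have p1 := Pr_ne hq
    have p2 := Pr_ne (npow_lt hq 2 (by norm_num))
    have p4 := Pr_ne (npow_lt hq 4 (by norm_num))
    have p8 := Pr_ne (npow_lt hq 8 (by norm_num))
    have base : EV (h2 ^ 3 * h8 ^ 2) q (Pr (q ^ 2) ^ 3 * Pr (q ^ 8) ^ 2) :=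
      EV_mul (EV_pow (EV_ex 2 (EV_h (npow_lt hq 2 (by norm_num)))) 3)
        (EV_pow (EV_ex 8 (EV_h (npow_lt hq 8 (by norm_num)))) 2)
    by_cases q0 : q = 0
    · subst q0
      have := EV_mul (EV_al_zero a) base
      simpa using this
    · obtain ⟨z, hz, hzq⟩ := exists_z q0 hq
      have hv := ha z hz
      have ht := t_pow z
      rw [eta1, eta2, eta4, eta8, hzq] at hv
      rw [hzq] at ht
      have t0 : Complex.exp (Real.pi * Complex.I * z / 12) ≠ 0 := Complex.exp_ne_zero _
      generalize Complex.exp (Real.pi * Complex.I * z / 12) = t at *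
      have hF : (t * Pr q) ^ (2 : ℤ) * (t ^ 2 * Pr (q ^ 2)) ^ (-3 : ℤ) * (t ^ 4 * Pr (q ^ 4)) ^ (11 : ℤ)
          * (t ^ 8 * Pr (q ^ 8)) ^ (-2 : ℤ)
          = q * Pr q ^ 2 * Pr (q ^ 4) ^ 11 / (Pr (q ^ 2) ^ 3 * Pr (q ^ 8) ^ 2) := by
        rw [← ht] at *
        simp only [zpow_neg, zpow_ofNat]
        field_simp
      rw [hF] at hv
      have := EV_mul (EV_al a q _ (div_ne_zero (by positivity) (by positivity)) hv) base
      rwa [div_mul_cancel₀ _ (by positivity)] at this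
  · intro q hq
    exact EV_mul (EV_mul (EV_X q) (EV_pow (EV_h hq) 2))
      (EV_pow (EV_ex 4 (EV_h (npow_lt hq 4 (by norm_num)))) 11)

/-- `f` is the generating series of the function `Q`. -/
def Rep {ι : Type} (Q : ι → ℕ) (f : ℚ⟦X⟧) : Prop :=
  ∀ n : ℕ, Finite {i : ι // Q i = n} ∧ coeff n f = Nat.card {i : ι // Q i = n}

lemma Rep_mul {ι κ : Type} {Q : ι → ℕ} {R : κ → ℕ} {f g : ℚ⟦X⟧} (hf : Rep Q f) (hg : Rep R g) :
    Rep (fun p : ι × κ => Q p.1 + R p.2) (f * g) := by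
  intro n
  let e : {p : ι × κ // Q p.1 + R p.2 = n} ≃
      Σ s : {s : ℕ × ℕ // s ∈ antidiagonal n}, {i : ι // Q i = s.1.1} × {j : κ // R j = s.1.2} :=
    { toFun := fun p => ⟨⟨(Q p.1.1, R p.1.2), HasAntidiagonal.mem_antidiagonal.2 p.2⟩, ⟨p.1.1, rfl⟩, ⟨p.1.2, rfl⟩⟩
      invFun := fun s => ⟨(s.2.1.1, s.2.2.1), by
        have := HasAntidiagonal.mem_antidiagonal.1 s.1.2
        rw [s.2.1.2, s.2.2.2]; exact this⟩
      left_inv := fun p => rfl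
      right_inv := by
        rintro ⟨⟨⟨a, b⟩, hs⟩, ⟨i, hi⟩, ⟨j, hj⟩⟩
        dsimp only at hi hj
        subst hi hj
        rfl }
  have : ∀ m, Finite {i : ι // Q i = m} := fun m => (hf m).1
  have : ∀ m, Finite {i : κ // R i = m} := fun m => (hg m).1
  refine ⟨Finite.of_equiv _ e.symm, ?_⟩
  rw [Nat.card_congr e, Nat.card_sigma, coeff_mul]
  simp only [Nat.card_prod]
  push_cast
  rw [Finset.sum_coe_sort (antidiagonal n)
    (fun s => (Nat.card {i : ι // Q i = s.1} : ℚ) * (Nat.card {j : κ // R j = s.2} : ℚ))]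
  refine sum_congr rfl fun s _ => ?_
  rw [(hf s.1).2, (hg s.2).2]

lemma Rep_A : Rep (fun x : ℤ => x.natAbs ^ 2) A := by
  intro n
  have key : ∀ x : ℤ, x ∈ (Finset.Icc (-(n : ℤ)) n).filter (fun x => x ^ 2 = (n : ℤ)) ↔ x.natAbs ^ 2 = n := by
    intro x
    rw [mem_sq, ← Int.natAbs_sq]
    norm_cast
  let e : {x : ℤ // x.natAbs ^ 2 = n} ≃ {x : ℤ // x ∈ (Finset.Icc (-(n : ℤ)) n).filter (fun x => x ^ 2 = (n : ℤ))} :=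
    Equiv.subtypeEquivRight fun x => (key x).symm
  refine ⟨Finite.of_equiv _ e.symm, ?_⟩
  rw [Nat.card_congr e, Nat.card_eq_fintype_card, Fintype.card_coe]
  unfold A Th
  rw [coeff_mk]; simp

lemma Rep_ex (c : ℕ) [NeZero c] {ι : Type} {Q : ι → ℕ} {f : ℚ⟦X⟧} (hf : Rep Q f) :
    Rep (fun i => c * Q i) (ex c f) := by
  have hc : 0 < c := Nat.pos_of_ne_zero (NeZero.ne c)
  intro n
  rw [coeff_ex]
  split_ifs with hd
  · obtain ⟨m, rfl⟩ := hd
    rw [Nat.mul_div_cancel_left _ hc]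
    let e : {i : ι // c * Q i = c * m} ≃ {i : ι // Q i = m} :=
      Equiv.subtypeEquivRight fun i => by simp [hc.ne']
    have := (hf m).1
    exact ⟨Finite.of_equiv _ e.symm, by rw [Nat.card_congr e, (hf m).2]⟩
  · have : IsEmpty {i : ι // c * Q i = n} := ⟨fun i => hd ⟨Q i.1, i.2.symm⟩⟩
    exact ⟨inferInstance, by simp⟩

lemma rep_eq (n : ℕ) : (repCount ![1, 1, 1, 1, 2, 4, 4, 4] n : ℚ) = coeff n (A ^ 4 * Cc * Ec ^ 3) := by
  have hC := Rep_ex 2 Rep_A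
  have hE := Rep_ex 4 Rep_A
  have H := Rep_mul Rep_A (Rep_mul Rep_A (Rep_mul Rep_A (Rep_mul Rep_A (Rep_mul hC
    (Rep_mul hE (Rep_mul hE hE))))))
  have hh := (H n).2
  have e0 : A * (A * (A * (A * (ex 2 A * (ex 4 A * (ex 4 A * ex 4 A)))))) = A ^ 4 * Cc * Ec ^ 3 := by
    unfold Cc Ec; ring
  rw [e0] at hh
  rw [hh]
  unfold repCount
  norm_cast
  let e : (Fin 8 → ℤ) ≃ ℤ × ℤ × ℤ × ℤ × ℤ × ℤ × ℤ × ℤ :=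
    { toFun := fun x => (x 0, x 1, x 2, x 3, x 4, x 5, x 6, x 7)
      invFun := fun p => ![p.1, p.2.1, p.2.2.1, p.2.2.2.1, p.2.2.2.2.1, p.2.2.2.2.2.1, p.2.2.2.2.2.2.1, p.2.2.2.2.2.2.2]
      left_inv := fun x => by funext i; fin_cases i <;> rfl
      right_inv := fun p => rfl }
  refine Nat.card_congr (e.subtypeEquiv fun x => ?_)
  have ee : e x = (x 0, x 1, x 2, x 3, x 4, x 5, x 6, x 7) := rfl
  rw [ee]
  clear_value e
  simp only [Fin.sum_univ_eight]
  simp only [Matrix.cons_val]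
  zify
  simp only [sq_abs]
  constructor <;> intro hx <;> push_cast at * <;> linarith

lemma coeff_E1 (n : ℕ) : coeff n E1 = (sigmaChi8One n : ℚ) := by
  unfold E1 sigmaChi8One
  rw [coeff_Lam, Nat.sum_divisorsAntidiagonal (f := fun a x => (a : ℚ) ^ 3 * ch (x : ℤ))]
  rw [Int.cast_sum]
  refine sum_congr rfl fun d _ => ?_
  unfold ch; rw [Int.cast_mul, Int.cast_pow, Int.cast_natCast, Int.cast_natCast]; ring

lemma coeff_E2 (n : ℕ) : coeff n E2 = (sigmaOneChi8 n : ℚ) := by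
  unfold E2 sigmaOneChi8
  rw [coeff_Lam, Nat.sum_divisorsAntidiagonal (f := fun a _ => (a : ℚ) ^ 3 * ch (a : ℤ))]
  push_cast
  refine sum_congr rfl fun d _ => ?_
  unfold ch; push_cast; ring

lemma coeff_al (a : ℕ → ℤ) (n : ℕ) (hn : 0 < n) : coeff n (al a) = (a n : ℚ) := by
  unfold al; rw [coeff_mk, if_neg hn.ne']

lemma coeff_ex_half (f : ℚ⟦X⟧) (a : ℕ → ℤ) (H : ∀ n, 0 < n → coeff n f = (a n : ℚ)) (n : ℕ) (hn : 0 < n) :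
    coeff n (ex 2 f) = half a n := by
  unfold half
  rw [coeff_ex]
  split_ifs with hd
  · exact H _ (Nat.div_pos (Nat.le_of_dvd hn hd) (by norm_num))
  · rfl

lemma coeff_num_mul (k : ℕ) [k.AtLeastTwo] (f : ℚ⟦X⟧) (n : ℕ) :
    coeff n ((OfNat.ofNat k : ℚ⟦X⟧) * f) = (OfNat.ofNat k : ℚ) * coeff n f := by
  rw [← map_ofNat C k, coeff_C_mul]

end RF8

theorem representation_formula_8
    (a1 a2 : ℕ → ℤ)
    (ha1 : ∀ z : ℂ, 0 < z.im →
      dedekindEta z ^ (-2 : ℤ) * dedekindEta (2 * z) ^ (11 : ℤ) * dedekindEta (4 * z) ^ (-3 : ℤ) * dedekindEta (8 * z) ^ (2 : ℤ)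
        = ∑' m : ℕ, (a1 (m + 1) : ℂ) * Complex.exp (2 * Real.pi * Complex.I * z) ^ (m + 1))
    (ha2 : ∀ z : ℂ, 0 < z.im →
      dedekindEta z ^ (2 : ℤ) * dedekindEta (2 * z) ^ (-3 : ℤ) * dedekindEta (4 * z) ^ (11 : ℤ) * dedekindEta (8 * z) ^ (-2 : ℤ)
        = ∑' m : ℕ, (a2 (m + 1) : ℂ) * Complex.exp (2 * Real.pi * Complex.I * z) ^ (m + 1))
    (n : ℕ) (hn : 0 < n) :
    (repCount ![1, 1, 1, 1, 2, 4, 4, 4] n : ℚ) =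
    (((16 : ℚ) / 11) * (sigmaChi8One n : ℚ) + ((2 : ℚ) / 11) * half sigmaOneChi8 n
      + ((4 : ℚ) / 11) * (a1 n : ℚ) + ((68 : ℚ) / 11) * (a2 n : ℚ)
      + ((180 : ℚ) / 11) * half a1 n + ((104 : ℚ) / 11) * half a2 n) := by
  have key := RF8.main_id (RF8.al a1) (RF8.al a2) (RF8.alpha1 _ (RF8.formal1 a1 ha1))
    (RF8.alpha2 _ (RF8.formal2 a2 ha2))
  have hk := congrArg (PowerSeries.coeff n) key
  have h11 : PowerSeries.coeff n (11 : PowerSeries ℚ) = 0 := by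
    rw [← map_ofNat PowerSeries.C 11, PowerSeries.coeff_C, if_neg hn.ne']
  simp only [map_add] at hk
  rw [RF8.coeff_num_mul 11, RF8.coeff_num_mul 16, RF8.coeff_num_mul 2, RF8.coeff_num_mul 4, RF8.coeff_num_mul 68,
    RF8.coeff_num_mul 180, RF8.coeff_num_mul 104, h11, ← RF8.rep_eq, RF8.coeff_E1,
    RF8.coeff_al a1 n hn, RF8.coeff_al a2 n hn,
    RF8.coeff_ex_half RF8.E2 sigmaOneChi8 (fun m _ => RF8.coeff_E2 m) n hn,
    RF8.coeff_ex_half (RF8.al a1) a1 (fun m hm => RF8.coeff_al a1 m hm) n hn,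
    RF8.coeff_ex_half (RF8.al a2) a2 (fun m hm => RF8.coeff_al a2 m hm) n hn] at hk
  linarith
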